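/- arXiv:2410.10990 — 4 statements merged into one kernel-verified Lean document; each statement's English description precedes it below -/
import Mathlib

section
/- Let R be a commutative Noetherian ring and let I, J ⊆ R be ideals such that J ∩ R° ≠ ∅. Then the colon ideal (IJ : J) is contained in the integral closure of I; that is, every x ∈ R with x·J ⊆ I·J satisfies an equation x^n + r₁x^{n-1} + ⋯ + rₙ = 0 for some n ≥ 1 and elements rᵢ ∈ Iⁱ (1 ≤ i ≤ n). -/
open Ideal Filter
open scoped Pointwise

/-- `R°`: the set of elements of `R` not contained in any minimal prime of `R`. -/
def Rcirc (R : Type*) [CommRing R] : Set R :=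
  {c | ∀ P ∈ minimalPrimes R, c ∉ P}

/-- The integral closure of an ideal `I`: elements satisfying an equation
`x^n + r₁ x^{n-1} + ⋯ + rₙ = 0` with `rᵢ ∈ Iⁱ`. -/
def intCl {R : Type*} [CommRing R] (I : Ideal R) : Set R :=
  {x | ∃ n : ℕ, 0 < n ∧ ∃ r : ℕ → R,
    (∀ i, 1 ≤ i → i ≤ n → r i ∈ I ^ i) ∧
    x ^ n + ∑ i ∈ Finset.range n, r (i + 1) * x ^ (n - (i + 1)) = 0}

/-- The Hara–Yoshida `𝔞^t`-integral closure of `I`. -/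
def HYIntCl {R : Type*} [CommRing R] (I a : Ideal R) (t : ℝ) : Set R :=
  {x | ∃ c ∈ Rcirc R, ∃ N : ℕ, ∀ n : ℕ, N ≤ n →
    ∀ y ∈ a ^ ⌈t * (n : ℝ)⌉₊, c * x ^ n * y ∈ I ^ n}

/-- The Vraciu `𝔞^t`-integral closure of `I`. -/
def VIntCl {R : Type*} [CommRing R] (I a : Ideal R) (t : ℝ) : Set R :=
  {x | ∃ c ∈ Rcirc R, ∃ N : ℕ, ∀ n : ℕ, N ≤ n →
    ∀ y ∈ a ^ ⌈t * (n : ℝ)⌉₊, c * x ^ n * y ∈ a ^ ⌈t * (n : ℝ)⌉₊ * I ^ n}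

/-- The `q`-th Frobenius bracket power `I^{[q]}`: the ideal generated by `q`-th powers
of elements of `I`. -/
def fbp {R : Type*} [CommRing R] (I : Ideal R) (q : ℕ) : Ideal R :=
  Ideal.span ((fun x => x ^ q) '' (I : Set R))

/-- The Frobenius closure `I^F` (in characteristic `p`). -/
def frobCl {R : Type*} [CommRing R] (p : ℕ) (I : Ideal R) : Set R :=
  {x | ∃ e : ℕ, x ^ p ^ e ∈ fbp I (p ^ e)}

/-- The tight closure `I^*` (in characteristic `p`). -/
def tightCl {R : Type*} [CommRing R] (p : ℕ) (I : Ideal R) : Set R :=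
  {x | ∃ c ∈ Rcirc R, ∃ E : ℕ, ∀ e : ℕ, E ≤ e → c * x ^ p ^ e ∈ fbp I (p ^ e)}

/-- The Hara–Yoshida `𝔞^t`-Frobenius closure of `I`. -/
def HYFrobCl {R : Type*} [CommRing R] (p : ℕ) (I a : Ideal R) (t : ℝ) : Set R :=
  {x | ∃ E : ℕ, ∀ e : ℕ, E ≤ e →
    ∀ y ∈ a ^ ⌈t * (p : ℝ) ^ e⌉₊, x ^ p ^ e * y ∈ fbp I (p ^ e)}

/-- The Vraciu `𝔞^t`-Frobenius closure of `I`. -/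
def VFrobCl {R : Type*} [CommRing R] (p : ℕ) (I a : Ideal R) (t : ℝ) : Set R :=
  {x | ∃ E : ℕ, ∀ e : ℕ, E ≤ e →
    ∀ y ∈ a ^ ⌈t * (p : ℝ) ^ e⌉₊, x ^ p ^ e * y ∈ a ^ ⌈t * (p : ℝ) ^ e⌉₊ * fbp I (p ^ e)}

/-- The Hara–Yoshida `𝔞^t`-tight closure of `I`. -/
def HYTightCl {R : Type*} [CommRing R] (p : ℕ) (I a : Ideal R) (t : ℝ) : Set R :=
  {x | ∃ c ∈ Rcirc R, ∃ E : ℕ, ∀ e : ℕ, E ≤ e →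
    ∀ y ∈ a ^ ⌈t * (p : ℝ) ^ e⌉₊, c * x ^ p ^ e * y ∈ fbp I (p ^ e)}

/-- The Vraciu `𝔞^t`-tight closure of `I`. -/
def VTightCl {R : Type*} [CommRing R] (p : ℕ) (I a : Ideal R) (t : ℝ) : Set R :=
  {x | ∃ c ∈ Rcirc R, ∃ E : ℕ, ∀ e : ℕ, E ≤ e →
    ∀ y ∈ a ^ ⌈t * (p : ℝ) ^ e⌉₊, c * x ^ p ^ e * y ∈ a ^ ⌈t * (p : ℝ) ^ e⌉₊ * fbp I (p ^ e)}

/-- The `t`-th rational power of an ideal `𝔞`, for `t = num/den ∈ ℚ`. -/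
def ratPow {R : Type*} [CommRing R] (a : Ideal R) (t : ℚ) : Set R :=
  {x | x ^ t.den ∈ intCl (a ^ t.num.toNat)}

/-- `μ(𝔞)`: the minimal number of generators of the ideal `𝔞`. -/
noncomputable def mu {R : Type*} [CommRing R] (a : Ideal R) : ℕ :=
  sInf {m | ∃ s : Finset R, s.card = m ∧ Ideal.span (s : Set R) = a}

open Polynomial in
/-- Polynomials with `k`-th coefficient in `I ^ (a - k)`, as `a` varies, are closed under products. -/
lemma coeff_mul_mem_pow_sub {R : Type*} [CommRing R] {I : Ideal R} {p q : R[X]} {a b : ℕ}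
    (hp : ∀ k, p.coeff k ∈ I ^ (a - k)) (hq : ∀ k, q.coeff k ∈ I ^ (b - k)) (k : ℕ) :
    (p * q).coeff k ∈ I ^ (a + b - k) := by
  rw [coeff_mul]
  refine Ideal.sum_mem _ fun ij hij => ?_
  have h := Ideal.mul_mem_mul (hp ij.1) (hq ij.2)
  rw [← pow_add] at h
  rw [Finset.HasAntidiagonal.mem_antidiagonal] at hij
  exact Ideal.pow_le_pow_right (by omega) h

open Polynomial in
lemma coeff_pow_mem_pow_sub {R : Type*} [CommRing R] {I : Ideal R} {p : R[X]} {a : ℕ}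
    (hp : ∀ k, p.coeff k ∈ I ^ (a - k)) (m k : ℕ) :
    (p ^ m).coeff k ∈ I ^ (m * a - k) := by
  induction m generalizing k with
  | zero => simp
  | succ m ih =>
    rw [pow_succ, Nat.succ_mul]
    exact coeff_mul_mem_pow_sub ih hp k

open Polynomial in
lemma mem_intCl_of_eval_eq_zero {R : Type*} [CommRing R] {I : Ideal R} {x : R} {p : R[X]} {n : ℕ}
    (hn : 0 < n) (hp : p.Monic) (hdeg : p.natDegree = n)
    (hcoeff : ∀ k, p.coeff k ∈ I ^ (n - k)) (hx : p.eval x = 0) :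
    x ∈ intCl I := by
  refine ⟨n, hn, fun i => p.coeff (n - i), fun i _ hi => ?_, ?_⟩
  · simpa [Nat.sub_sub_self hi] using hcoeff (n - i)
  · have hlead : p.coeff n = 1 := hdeg ▸ hp.coeff_natDegree
    rw [eval_eq_sum_range, hdeg, Finset.sum_range_succ, hlead, one_mul, add_comm] at hx
    rw [← hx, ← Finset.sum_range_reflect (fun i => p.coeff i * x ^ i)]
    congr 1
    refine Finset.sum_congr rfl fun i _ => ?_
    simp only [Nat.sub_sub, add_comm 1 i]

lemma isNilpotent_of_mul_eq_zero_of_mem_Rcirc {R : Type*} [CommRing R] {a c : R}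
    (hc : c ∈ Rcirc R) (h : a * c = 0) : IsNilpotent a := by
  rw [← mem_nilradical, nilradical, ← Ideal.sInf_minimalPrimes, Ideal.mem_sInf]
  intro P hP
  have : P.IsPrime := hP.1.1
  exact (this.mem_or_mem (h ▸ P.zero_mem)).resolve_right (hc P hP)

theorem determinantal_trick {R : Type*} [CommRing R] [IsNoetherianRing R]
    (I J : Ideal R) (hJ : ∃ c ∈ Rcirc R, c ∈ J) (x : R)
    (hx : ∀ y ∈ J, x * y ∈ I * J) :
    x ∈ intCl I := by
  obtain ⟨c, hc, hcJ⟩ := hJ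
  cases subsingleton_or_nontrivial R
  · exact ⟨1, one_pos, 0, by simp, Subsingleton.elim _ _⟩
  have hrange : LinearMap.range (algebraMap R (Module.End R J) x) ≤ I • ⊤ := by
    rintro _ ⟨y, rfl⟩
    exact (Submodule.mem_smul_top_iff I J _).2 (hx y y.2)
  obtain ⟨p, hp, -, hcoeff, hzero⟩ :=
    LinearMap.exists_monic_and_natDegree_eq_and_coeff_mem_pow_and_aeval_eq_zero R _ I hrange
  rw [Polynomial.aeval_algebraMap_apply] at hzero
  have hpc : p.eval x * c = 0 := by
    simpa using congrArg Subtype.val (LinearMap.congr_fun hzero ⟨c, hcJ⟩)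
  obtain ⟨m, hm⟩ := isNilpotent_of_mul_eq_zero_of_mem_Rcirc hc hpc
  have hX (k : ℕ) : (Polynomial.X : Polynomial R).coeff k ∈ I ^ (1 - k) := by
    rcases k with - | k <;> simp
  refine mem_intCl_of_eval_eq_zero (p := p ^ m * Polynomial.X) (Nat.succ_pos _)
    ((hp.pow m).mul Polynomial.monic_X) ?_
    (coeff_mul_mem_pow_sub (coeff_pow_mem_pow_sub hcoeff m) hX) (by simp [hm])
  rw [(hp.pow m).natDegree_mul Polynomial.monic_X, hp.natDegree_pow, Polynomial.natDegree_X]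
end

section
/- Let R be a commutative Noetherian ring, let I, 𝔞 ⊆ R be ideals with 𝔞 ∩ R° ≠ ∅, and let t > 0 be a real number. Then both the Hara–Yoshida 𝔞ᵗ-integral closure Ī^{𝔞ᵗ} and the Vraciu 𝔞ᵗ-integral closure ^{𝔞ᵗ}Ī are ideals of R (in particular, each is closed under addition and under multiplication by arbitrary elements of R). -/
open Ideal Filter
open scoped Pointwise

section Rcirc

variable {R : Type*} [CommRing R]

lemma one_mem_Rcirc : (1 : R) ∈ Rcirc R := fun _ hP h =>
  hP.1.1.ne_top ((Ideal.eq_top_iff_one _).2 h)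

lemma mul_mem_Rcirc {c d : R} (hc : c ∈ Rcirc R) (hd : d ∈ Rcirc R) : c * d ∈ Rcirc R :=
  fun P hP h => (hP.1.1.mem_or_mem h).elim (hc P hP) (hd P hP)

lemma exists_mem_Rcirc_of_not_le [IsNoetherianRing R] {J : Ideal R}
    (hJ : ∀ P ∈ minimalPrimes R, ¬ J ≤ P) : ∃ c ∈ Rcirc R, c ∈ J := by
  have h := (subset_union_prime_finite (f := fun P : Ideal R => P) (I := J)
    (minimalPrimes.finite_of_isNoetherianRing R) ⊥ ⊥ fun P hP _ _ => hP.1.1).not.2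
      (by rintro ⟨P, hP, h⟩; exact hJ P hP h)
  obtain ⟨c, hcJ, hc⟩ := Set.not_subset.1 h
  refine ⟨c, fun P hP hcP => hc ?_, hcJ⟩
  exact Set.mem_biUnion hP hcP

lemma ker_algebraMap_away_not_le {P : Ideal R} (hP : P ∈ minimalPrimes R) {x : R} (hx : x ∈ P) :
    ¬ RingHom.ker (algebraMap R (Localization.Away x)) ≤ P := by
  intro hle
  obtain ⟨Q, hQ, -, hQP⟩ := Ideal.exists_comap_eq_of_mem_minimalPrimes
    (algebraMap R (Localization.Away x)) (I := ⊥) P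
    ⟨⟨hP.1.1, hle⟩, fun K hK hKP => hP.2 ⟨hK.1, bot_le⟩ hKP⟩
  rw [← hQP, Ideal.mem_comap] at hx
  exact hQ.ne_top (Ideal.eq_top_of_isUnit_mem _ hx (IsLocalization.Away.algebraMap_isUnit x))

/-- If `x` lies in every minimal prime containing `I`, then some element of `R°` is the sum of an
element of `I ^ N` and an element annihilated by a power of `x`. -/
lemma exists_add_mem_Rcirc [IsNoetherianRing R] {I : Ideal R} {x : R}
    (hx : ∀ P ∈ minimalPrimes R, I ≤ P → x ∈ P) (N : ℕ) :
    ∃ u ∈ I ^ N, ∃ v : R, ∃ M : ℕ, u + v ∈ Rcirc R ∧ v * x ^ M = 0 := by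
  obtain ⟨c, hc, hcJ⟩ := exists_mem_Rcirc_of_not_le
    (J := I ^ N ⊔ RingHom.ker (algebraMap R (Localization.Away x))) fun P hP hle => by
      have hIP : I ≤ P := by
        have := hP.1.1
        exact Ideal.IsPrime.le_of_pow_le (le_sup_left.trans hle)
      exact ker_algebraMap_away_not_le hP (hx P hP hIP) (le_sup_right.trans hle)
  obtain ⟨u, hu, v, hv, rfl⟩ := Submodule.mem_sup.1 hcJ
  obtain ⟨⟨_, M, rfl⟩, hM⟩ :=
    (IsLocalization.map_eq_zero_iff (Submonoid.powers x) (Localization.Away x) v).1 hv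
  exact ⟨u, hu, v, M, hc, by rw [mul_comm]; exact hM⟩

end Rcirc

section adjustedIntCl

variable {R : Type*} [CommRing R]

/-- The common form of the two closures: `b = 1` gives the Hara–Yoshida closure and `b = a` the
Vraciu closure. -/
def adjustedIntCl (I a b : Ideal R) (t : ℝ) : Set R :=
  {x | ∃ c ∈ Rcirc R, ∃ N : ℕ, ∀ n : ℕ, N ≤ n →
    span {c * x ^ n} * a ^ ⌈t * (n : ℝ)⌉₊ ≤ b ^ ⌈t * (n : ℝ)⌉₊ * I ^ n}

lemma HYIntCl_eq_adjustedIntCl (I a : Ideal R) (t : ℝ) : HYIntCl I a t = adjustedIntCl I a 1 t := by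
  simp only [HYIntCl, adjustedIntCl, span_singleton_mul_le_iff, one_pow, one_mul]

lemma VIntCl_eq_adjustedIntCl (I a : Ideal R) (t : ℝ) : VIntCl I a t = adjustedIntCl I a a t := by
  simp only [VIntCl, adjustedIntCl, span_singleton_mul_le_iff]

variable {I a b : Ideal R} {t : ℝ}

lemma mem_minimalPrime_of_mem_adjustedIntCl (ha : ∃ c ∈ Rcirc R, c ∈ a) {x : R}
    (hx : x ∈ adjustedIntCl I a b t) {P : Ideal R} (hP : P ∈ minimalPrimes R) (hIP : I ≤ P) :
    x ∈ P := by
  obtain ⟨d, hd, hda⟩ := ha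
  obtain ⟨c, hc, N, h⟩ := hx
  have hprime : P.IsPrime := hP.1.1
  obtain ⟨n, hNn, hn⟩ : ∃ n, N ≤ n ∧ n ≠ 0 := ⟨N + 1, N.le_succ, N.succ_ne_zero⟩
  have hmem := span_singleton_mul_le_iff.1 (h n hNn) _ (Ideal.pow_mem_pow hda _)
  have hle : b ^ ⌈t * (n : ℝ)⌉₊ * I ^ n ≤ P :=
    Ideal.mul_le_right.trans ((Ideal.pow_le_self hn).trans hIP)
  have hmemP := hle hmem
  rcases hprime.mem_or_mem hmemP with h1 | h1
  · exact hprime.mem_of_pow_mem _ ((hprime.mem_or_mem h1).resolve_left (hc P hP))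
  · exact absurd (hprime.mem_of_pow_mem _ h1) (hd P hP)

lemma span_mul_mul_pow_le (hab : a ≤ b) {d z w : R} (hd : d ∈ a) {p q r i j : ℕ}
    (hpq : p + q ≤ r + 1) (hz : span {z} * a ^ p ≤ b ^ p * I ^ i)
    (hw : span {w} * a ^ q ≤ b ^ q * I ^ j) :
    span {d * (z * w)} * a ^ r ≤ b ^ r * I ^ (i + j) := by
  obtain ⟨k, hk⟩ := Nat.exists_eq_add_of_le hpq
  calc span {d * (z * w)} * a ^ r
      = span {d} * (span {z} * span {w}) * a ^ r := by
        simp only [span_singleton_mul_span_singleton]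
    _ ≤ a * (span {z} * span {w}) * a ^ r :=
        Ideal.mul_mono_left (Ideal.mul_mono_left ((span_singleton_le_iff_mem _).2 hd))
    _ = span {z} * span {w} * a ^ (r + 1) := by ring
    _ = (span {z} * a ^ p) * (span {w} * a ^ q) * a ^ k := by rw [hk]; ring
    _ ≤ (b ^ p * I ^ i) * (b ^ q * I ^ j) * b ^ k :=
        Ideal.mul_mono (Ideal.mul_mono hz hw) (Ideal.pow_right_mono hab k)
    _ = b ^ (r + 1) * I ^ (i + j) := by rw [hk]; ring
    _ ≤ b ^ r * I ^ (i + j) := Ideal.mul_mono_left (Ideal.pow_le_pow_right r.le_succ)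

lemma span_mul_pow_le_of_mem_pow (hab : a ≤ b) {u z : R} {N q r j n : ℕ} (hu : u ∈ I ^ N)
    (hqr : q ≤ r) (hn : n ≤ N + j) (hz : span {z} * a ^ q ≤ b ^ q * I ^ j) :
    span {u * z} * a ^ r ≤ b ^ r * I ^ n := by
  obtain ⟨k, rfl⟩ := Nat.exists_eq_add_of_le hqr
  calc span {u * z} * a ^ (q + k)
      = span {u} * (span {z} * a ^ q) * a ^ k := by
        rw [← span_singleton_mul_span_singleton]; ring
    _ ≤ I ^ N * (b ^ q * I ^ j) * b ^ k :=
        Ideal.mul_mono (Ideal.mul_mono ((span_singleton_le_iff_mem _).2 hu) hz)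
          (Ideal.pow_right_mono hab k)
    _ = b ^ (q + k) * I ^ (N + j) := by ring
    _ ≤ b ^ (q + k) * I ^ n := Ideal.mul_mono_right (Ideal.pow_le_pow_right hn)

lemma span_mul_le_of_span_le {s J K : Ideal R} {z : R} (h : span {z} * s ≤ J * K) (e : R) :
    span {e * z} * s ≤ J * K := by
  rw [← span_singleton_mul_span_singleton, mul_assoc]
  exact Ideal.mul_le_right.trans h

lemma ceil_mul_mono (ht : 0 ≤ t) {m n : ℕ} (h : m ≤ n) : ⌈t * (m : ℝ)⌉₊ ≤ ⌈t * (n : ℝ)⌉₊ :=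
  Nat.ceil_mono (mul_le_mul_of_nonneg_left (Nat.cast_le.2 h) ht)

lemma ceil_mul_add_ceil_mul_le (ht : 0 ≤ t) (i j : ℕ) :
    ⌈t * (i : ℝ)⌉₊ + ⌈t * (j : ℝ)⌉₊ ≤ ⌈t * ((i + j : ℕ) : ℝ)⌉₊ + 1 := by
  have hi := Nat.ceil_lt_add_one (mul_nonneg ht (Nat.cast_nonneg (α := ℝ) i))
  have hj := Nat.ceil_lt_add_one (mul_nonneg ht (Nat.cast_nonneg (α := ℝ) j))
  have hn := Nat.le_ceil (t * ((i + j : ℕ) : ℝ))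
  rw [← Nat.lt_add_one_iff, ← Nat.cast_lt (α := ℝ)]
  push_cast at *
  linarith

/-- The terms `x ^ i * y ^ j` with `i` small. -/
lemma exists_mul_pow_mul_pow_le [IsNoetherianRing R] (ha : ∃ c ∈ Rcirc R, c ∈ a) (hab : a ≤ b)
    (ht : 0 ≤ t) {y : R} (hy : y ∈ adjustedIntCl I a b t) (N : ℕ) :
    ∃ g ∈ Rcirc R, ∃ L : ℕ, ∀ (x : R) (i j : ℕ), i ≤ N → L ≤ j →
      span {g * (x ^ i * y ^ j)} * a ^ ⌈t * ((i + j : ℕ) : ℝ)⌉₊ ≤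
        b ^ ⌈t * ((i + j : ℕ) : ℝ)⌉₊ * I ^ (i + j) := by
  obtain ⟨u, hu, v, M, huv, hv⟩ := exists_add_mem_Rcirc
    (fun P hP hIP => mem_minimalPrime_of_mem_adjustedIntCl ha hy hP hIP) N
  obtain ⟨c, hc, K, hK⟩ := hy
  refine ⟨(u + v) * c, mul_mem_Rcirc huv hc, M + K, fun x i j hi hj => ?_⟩
  have hvj : v * y ^ j = 0 := by
    rw [← Nat.add_sub_of_le ((Nat.le_add_right M K).trans hj), pow_add, ← mul_assoc, hv, zero_mul]
  have heq : (u + v) * c * (x ^ i * y ^ j) = x ^ i * (u * (c * y ^ j)) := by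
    linear_combination c * x ^ i * hvj
  rw [heq]
  exact span_mul_le_of_span_le (span_mul_pow_le_of_mem_pow hab hu
    (ceil_mul_mono ht (Nat.le_add_left j i)) (by omega) (hK j (by omega))) _

lemma add_mem_adjustedIntCl [IsNoetherianRing R] (ha : ∃ c ∈ Rcirc R, c ∈ a) (hab : a ≤ b)
    (ht : 0 ≤ t) {x y : R} (hx : x ∈ adjustedIntCl I a b t) (hy : y ∈ adjustedIntCl I a b t) :
    x + y ∈ adjustedIntCl I a b t := by
  obtain ⟨d, hd, hda⟩ := id ha
  obtain ⟨c₁, hc₁, N₁, h₁⟩ := id hx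
  obtain ⟨c₂, hc₂, N₂, h₂⟩ := id hy
  obtain ⟨g₁, hg₁, L₁, hL₁⟩ := exists_mul_pow_mul_pow_le ha hab ht hx N₂
  obtain ⟨g₂, hg₂, L₂, hL₂⟩ := exists_mul_pow_mul_pow_le ha hab ht hy N₁
  refine ⟨d * c₁ * c₂ * g₁ * g₂, mul_mem_Rcirc (mul_mem_Rcirc (mul_mem_Rcirc (mul_mem_Rcirc hd hc₁)
    hc₂) hg₁) hg₂, N₁ + N₂ + L₁ + L₂, fun n hn => span_singleton_mul_le_iff.2 fun w hw => ?_⟩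
  rw [(Commute.all x y).add_pow', Finset.mul_sum, Finset.sum_mul]
  refine Ideal.sum_mem _ fun m hm => ?_
  obtain ⟨i, j⟩ := m
  obtain rfl : i + j = n := Finset.HasAntidiagonal.mem_antidiagonal.1 hm
  suffices h : ∃ e f : R, d * c₁ * c₂ * g₁ * g₂ * (x ^ i * y ^ j) = e * f ∧
      span {f} * a ^ ⌈t * ((i + j : ℕ) : ℝ)⌉₊ ≤
        b ^ ⌈t * ((i + j : ℕ) : ℝ)⌉₊ * I ^ (i + j) by
    obtain ⟨e, f, hef, hf⟩ := h
    rw [mul_smul_comm, smul_mul_assoc, hef]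
    exact nsmul_mem (span_singleton_mul_le_iff.1 (span_mul_le_of_span_le hf e) w hw) _
  by_cases hi : i < N₁
  · exact ⟨d * c₁ * c₂ * g₁, _, by ring, hL₂ x i j hi.le (by omega)⟩
  by_cases hj : j < N₂
  · refine ⟨d * c₁ * c₂ * g₂, g₁ * (y ^ j * x ^ i), by ring, ?_⟩
    rw [add_comm i j]
    exact hL₁ y j i hj.le (by omega)
  · exact ⟨g₁ * g₂, _, by ring, span_mul_mul_pow_le hab hda (ceil_mul_add_ceil_mul_le ht i j)
      (h₁ i (by omega)) (h₂ j (by omega))⟩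

lemma exists_ideal_eq_adjustedIntCl [IsNoetherianRing R] (ha : ∃ c ∈ Rcirc R, c ∈ a)
    (hab : a ≤ b) (ht : 0 ≤ t) : ∃ J : Ideal R, (J : Set R) = adjustedIntCl I a b t := by
  refine ⟨{ carrier := adjustedIntCl I a b t
            add_mem' := add_mem_adjustedIntCl ha hab ht
            zero_mem' := ⟨1, one_mem_Rcirc, 1, fun n hn => ?_⟩
            smul_mem' := ?_ }, rfl⟩
  · simp [zero_pow (Nat.one_le_iff_ne_zero.1 hn)]
  · rintro r x ⟨c, hc, N, h⟩
    refine ⟨c, hc, N, fun n hn => ?_⟩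
    rw [smul_eq_mul, mul_pow, mul_left_comm]
    exact span_mul_le_of_span_le (h n hn) _

end adjustedIntCl

theorem adjusted_integral_closures_are_ideals {R : Type*} [CommRing R] [IsNoetherianRing R]
    (I a : Ideal R) (ha : ∃ c ∈ Rcirc R, c ∈ a) (t : ℝ) (ht : 0 < t) :
    (∃ J : Ideal R, (J : Set R) = HYIntCl I a t) ∧
    (∃ J : Ideal R, (J : Set R) = VIntCl I a t) := by
  rw [HYIntCl_eq_adjustedIntCl, VIntCl_eq_adjustedIntCl]
  exact ⟨exists_ideal_eq_adjustedIntCl ha (Ideal.one_eq_top (R := R) ▸ le_top) ht.le,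
    exists_ideal_eq_adjustedIntCl ha le_rfl ht.le⟩
end

section
/- Let R be a commutative Noetherian ring of prime characteristic p > 0, let I, 𝔞 ⊆ R be ideals, and let t > 0 be a real number. Then the Hara–Yoshida 𝔞ᵗ-tight closure is contained in the Hara–Yoshida 𝔞ᵗ-integral closure, I^{*𝔞ᵗ} ⊆ Ī^{𝔞ᵗ}, and the Vraciu 𝔞ᵗ-tight closure is contained in the Vraciu 𝔞ᵗ-integral closure, ^{𝔞ᵗ}I* ⊆ ^{𝔞ᵗ}Ī. -/
open Ideal Filter
open scoped Pointwise

lemma exists_mem_sup_span_image_Ioi_of_isLocalRing {B : Type*} [CommRing B] [IsNoetherianRing B]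
    [IsLocalRing B] (b : Ideal B) (a : ℕ → B)
    (h : ∀ i, ∃ k, ∀ x ∈ IsLocalRing.maximalIdeal B ^ k, x * a i ∈ b) :
    ∃ i, a i ∈ b ⊔ span (a '' Set.Ioi i) := by
  set m := IsLocalRing.maximalIdeal B
  let H : Ideal B := span (Set.range a)
  have hH : ∃ k, m ^ k * H ≤ b := by
    obtain ⟨T, hT, hspan⟩ := (Submodule.fg_span_iff_fg_span_finset_subset (R := B)
      (Set.range a)).1 (IsNoetherian.noetherian H)
    have key : ∀ z ∈ T, ∃ k, ∀ x ∈ m ^ k, x * z ∈ b := by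
      intro z hz
      obtain ⟨i, rfl⟩ := hT hz
      exact h i
    choose! k hk using key
    refine ⟨T.sup k, ?_⟩
    rw [show H = span (T : Set B) from hspan, Ideal.mul_le]
    intro x hx y hy
    have : span (T : Set B) ≤ b.colon {x} := by
      rw [Ideal.span_le]
      intro z hz
      rw [SetLike.mem_coe, Submodule.mem_colon_singleton, smul_eq_mul, mul_comm]
      exact hk z hz x (Ideal.pow_le_pow_right (Finset.le_sup hz) hx)
    have := Submodule.mem_colon_singleton.1 (this hy)
    rwa [smul_eq_mul, mul_comm] at this
  obtain ⟨k, hk⟩ := hH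
  obtain ⟨r, hr⟩ := Ideal.exists_pow_inf_eq_pow_smul m H
  have hinf : m ^ (r + k) ⊓ H ≤ b := by
    have := hr (r + k) (by omega)
    simp only [smul_eq_mul, Ideal.mul_top, add_tsub_cancel_left] at this
    rw [this]
    exact (Ideal.mul_mono_right inf_le_right).trans hk
  set n := r + k
  rcases Nat.eq_zero_or_pos n with hn | hn
  · rw [hn, pow_zero, Ideal.one_eq_top, top_inf_eq] at hinf
    exact ⟨0, Ideal.mem_sup_left (hinf (Ideal.subset_span ⟨0, rfl⟩))⟩
  have hnt : m ^ n ≠ ⊤ := fun h' => by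
    have := (Ideal.pow_le_self hn.ne').trans' h'.ge
    exact (IsLocalRing.maximalIdeal.isMaximal B).ne_top (top_le_iff.1 this)
  have : Nontrivial (B ⧸ m ^ n) := Ideal.Quotient.nontrivial_iff.2 hnt
  have : IsLocalRing (B ⧸ m ^ n) :=
    IsLocalRing.of_surjective' (Ideal.Quotient.mk _) Ideal.Quotient.mk_surjective
  have hart : IsArtinianRing (B ⧸ m ^ n) := by
    rw [isArtinianRing_iff_isNilpotent_maximalIdeal]
    refine ⟨n, ?_⟩
    have hmap : IsLocalRing.maximalIdeal (B ⧸ m ^ n) = m.map (Ideal.Quotient.mk (m ^ n)) := by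
      have := ((IsLocalRing.local_hom_TFAE (Ideal.Quotient.mk (m ^ n))).out 0 4).1
        (IsLocalHom.of_surjective _ Ideal.Quotient.mk_surjective)
      have h2 := Ideal.map_comap_of_surjective (Ideal.Quotient.mk (m ^ n))
        Ideal.Quotient.mk_surjective (IsLocalRing.maximalIdeal (B ⧸ m ^ n))
      rw [this] at h2
      exact h2.symm
    rw [hmap, ← Ideal.map_pow, Ideal.map_quotient_self, Ideal.zero_eq_bot]
  let G : ℕ → Ideal (B ⧸ m ^ n) := fun i => (span (a '' Set.Ici i)).map (Ideal.Quotient.mk (m ^ n))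
  have hG : Antitone G := fun i j hij =>
    Ideal.map_mono (Ideal.span_mono (Set.image_mono (Set.Ici_subset_Ici.2 hij)))
  obtain ⟨i, hi⟩ := IsArtinian.monotone_stabilizes
    (⟨fun i => OrderDual.toDual (G i), fun i j hij => hG hij⟩ :
      ℕ →o (Submodule (B ⧸ m ^ n) (B ⧸ m ^ n))ᵒᵈ)
  have hi' : G i = G (i + 1) := congrArg OrderDual.ofDual (hi (i + 1) (by omega))
  have hmem : Ideal.Quotient.mk (m ^ n) (a i) ∈ G (i + 1) :=
    hi' ▸ Ideal.mem_map_of_mem _ (Ideal.subset_span ⟨i, Set.self_mem_Ici, rfl⟩)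
  obtain ⟨z, hz, hza⟩ := (Ideal.mem_map_iff_of_surjective _ Ideal.Quotient.mk_surjective).1 hmem
  have hz' : z ∈ span (a '' Set.Ioi i) := by
    rwa [show Set.Ici (i + 1) = Set.Ioi i from Set.Ici_add_one_eq_Ioi i] at hz
  have hsub : a i - z ∈ b := hinf ⟨by
    rw [SetLike.mem_coe, ← Ideal.Quotient.eq]; exact hza.symm, by
    exact H.sub_mem (Ideal.subset_span ⟨i, rfl⟩)
      (Ideal.span_mono (Set.image_subset_range _ _) hz')⟩
  refine ⟨i, ?_⟩
  rw [← sub_add_cancel (a i) z]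
  exact Ideal.add_mem _ (Ideal.mem_sup_left hsub) (Ideal.mem_sup_right hz')

lemma exists_prime_strictMono_mem_sup_span {A : Type*} [CommRing A] [IsNoetherianRing A]
    (b : Ideal A) (a : ℕ → A) (ha : ∀ i, a i ∉ b) :
    ∃ (P : Ideal A) (φ : ℕ → ℕ), P.IsPrime ∧ StrictMono φ ∧
      (∀ i x, x * a (φ i) ∈ b → x ∈ P) ∧
      ∃ i, ∃ s, s ∉ P ∧ s * a (φ i) ∈ b ⊔ span ((a ∘ φ) '' Set.Ioi i) := by
  have hmin : ∀ i, ∃ P, P ∈ (Submodule.colon b {a i}).minimalPrimes := fun i => by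
    have hne : Submodule.colon b {a i} ≠ ⊤ := fun h => ha i <| by
      have := (Ideal.eq_top_iff_one _).1 h
      rwa [Submodule.mem_colon_singleton, one_smul] at this
    obtain ⟨P, hP, hle⟩ := Ideal.exists_le_maximal _ hne
    have := hP.isPrime
    obtain ⟨Q, hQ, -⟩ := Ideal.exists_minimalPrimes_le hle
    exact ⟨Q, hQ⟩
  choose P hP using hmin
  have hass : ∀ i, P i ∈ associatedPrimes A (A ⧸ b) := fun i => by
    obtain ⟨x, hx⟩ := Submodule.exists_eq_colon_of_mem_minimalPrimes (hP i)
    refine isAssociatedPrime_iff.2 ?_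
    refine ⟨(hP i).1.1, Ideal.Quotient.mk b x, ?_⟩
    ext y
    rw [hx, Submodule.mem_colon_singleton, Submodule.mem_colon_singleton, Submodule.mem_bot,
      ← Ideal.Quotient.mk_eq_mk, ← Submodule.Quotient.mk_smul, Submodule.Quotient.mk_eq_zero]
  have hfin := associatedPrimes.finite A (A ⧸ b)
  have : ∃ Q, Q ∈ associatedPrimes A (A ⧸ b) ∧ {i | P i = Q}.Infinite := by
    have := Set.infinite_univ (α := ℕ)
    by_contra! hcon
    refine this ((hfin.biUnion fun Q hQ => hcon Q hQ).subset fun i _ => ?_)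
    exact Set.mem_biUnion (hass i) rfl
  obtain ⟨Q, hQ, hinf⟩ := this
  obtain ⟨φ, hφ, hφQ⟩ := Nat.exists_strictMono_subsequence (P := fun i => P i = Q)
    fun N => by
      obtain ⟨n, hn, hN⟩ := hinf.exists_gt N
      exact ⟨n, hN, hn⟩
  have hQp : Q.IsPrime := hQ.1
  have hQmin : ∀ i, Q ∈ (Submodule.colon b {a (φ i)}).minimalPrimes := fun i => hφQ i ▸ hP _
  refine ⟨Q, φ, hQp, hφ, fun i x hx => (hQmin i).1.2 ?_, ?_⟩
  · rwa [Submodule.mem_colon_singleton]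
  let B := Localization.AtPrime Q
  obtain ⟨i, hi⟩ := exists_mem_sup_span_image_Ioi_of_isLocalRing (b.map (algebraMap A B))
    (fun i => algebraMap A B (a (φ i))) fun i => by
      have h1 := IsLocalization.AtPrime.radical_map_of_mem_minimalPrimes B Q _ (hQmin i)
      rw [Localization.AtPrime.map_eq_maximalIdeal] at h1
      obtain ⟨k, hk⟩ := Ideal.exists_pow_le_of_le_radical_of_fg h1.ge (IsNoetherian.noetherian _)
      refine ⟨k, fun x hx => ?_⟩
      obtain ⟨⟨⟨y, hy⟩, s⟩, hys⟩ :=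
        (IsLocalization.mem_map_algebraMap_iff Q.primeCompl B).1 (hk hx)
      rw [Submodule.mem_colon_singleton, smul_eq_mul] at hy
      rw [← Ideal.unit_mul_mem_iff_mem _ (IsLocalization.map_units B s), ← mul_assoc,
        mul_comm (algebraMap A B s), hys, ← map_mul]
      exact Ideal.mem_map_of_mem _ hy
  refine ⟨i, ?_⟩
  rw [show (fun i => algebraMap A B (a (φ i))) '' Set.Ioi i =
      algebraMap A B '' ((a ∘ φ) '' Set.Ioi i) by rw [← Set.image_comp]; rfl,
    ← Ideal.map_span, ← Ideal.map_sup,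
    IsLocalization.algebraMap_mem_map_algebraMap_iff Q.primeCompl] at hi
  obtain ⟨s, hs, h⟩ := hi
  exact ⟨s, hs, h⟩

/-- An element lying in every valuation ring of `K` that contains `A` is integral over `A`. -/
lemma isIntegral_of_forall_valuationSubring {A K : Type*} [CommRing A] [Field K] [Algebra A K]
    {z : K} (h : ∀ V : ValuationSubring K, (∀ a : A, algebraMap A K a ∈ V) → z ∈ V) :
    IsIntegral A z := by
  by_contra hz
  have : IsIntegrallyClosedIn (integralClosure A K).toSubring K :=
    inferInstanceAs (IsIntegrallyClosedIn (integralClosure A K) K)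
  obtain ⟨V, hV, hzV⟩ := Subring.exists_le_valuationSubring_of_isIntegrallyClosedIn
    (R := (integralClosure A K).toSubring) (x := z) hz
  exact hzV (h V fun a => hV (algebraMap_mem (integralClosure A K) a))

lemma mem_valuationSubring_of_isIntegral {A K : Type*} [CommRing A] [Field K] [Algebra A K]
    {z : K} (hz : IsIntegral A z) (V : ValuationSubring K)
    (hV : ∀ a : A, algebraMap A K a ∈ V) : z ∈ V := by
  obtain ⟨x, rfl⟩ := IsIntegrallyClosedIn.algebraMap_eq_of_integral (R := V) (A := K)
    (x := z) (by
      obtain ⟨f, hf, hfz⟩ := hz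
      refine ⟨f.map ((algebraMap A K).codRestrict V hV), hf.map _, ?_⟩
      rwa [Polynomial.eval₂_map])
  exact x.2

lemma isIntegral_of_mem_span {A K : Type*} [CommRing A] [Field K] [Algebra A K]
    {z w : K} {S : Set K} (hw0 : w ≠ 0) (hw : w ∈ Submodule.span A S)
    (h : ∀ V : ValuationSubring K, (∀ a : A, algebraMap A K a ∈ V) → 1 < V.valuation z →
      ∀ s ∈ S, V.valuation s < V.valuation w) : IsIntegral A z := by
  refine isIntegral_of_forall_valuationSubring fun V hV => ?_
  by_contra hz
  rw [← V.valuation_le_one_iff, not_le] at hz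
  have hlt := h V hV hz
  have h0 : 0 < V.valuation w := zero_lt_iff.2 ((V.valuation.ne_zero_iff).2 hw0)
  suffices ∀ x ∈ Submodule.span A S, V.valuation x < V.valuation w from (this w hw).false
  intro x hx
  induction hx using Submodule.span_induction with
  | mem s hs => exact hlt s hs
  | zero => simpa using h0
  | add x y _ _ hx hy => exact V.valuation.map_add_lt hx hy
  | smul a x _ hx =>
    rw [Algebra.smul_def, map_mul]
    exact (mul_le_of_le_one_left' ((V.valuation_le_one_iff _).2 (hV a))).trans_lt hx

lemma exists_mem_span_image_Iio {A K : Type*} [CommRing A] [IsNoetherianRing A] [Field K]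
    [Algebra A K] {c : K} (hc : c ≠ 0) (w : ℕ → K)
    (h : ∀ i, ∃ a : A, algebraMap A K a = c * w i) :
    ∃ i, w i ∈ Submodule.span A (w '' Set.Iio i) := by
  choose a ha using h
  obtain ⟨n, hn⟩ := monotone_stabilizes_iff_noetherian.2 (inferInstance : IsNoetherian A A)
    ⟨fun i => span (a '' Set.Iio i), fun i j hij =>
      Ideal.span_mono (Set.image_mono (Set.Iio_subset_Iio hij))⟩
  have hmem : a n ∈ span (a '' Set.Iio n) := by
    rw [show span (a '' Set.Iio n) = span (a '' Set.Iio (n + 1)) from hn (n + 1) (by omega)]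
    exact Ideal.subset_span ⟨n, by simp, rfl⟩
  refine ⟨n, ?_⟩
  have h1 := Submodule.mem_map_of_mem (f := Algebra.linearMap A K) hmem
  rw [Ideal.span, Submodule.map_span, ← Set.image_comp] at h1
  have h2 : (Algebra.linearMap A K ∘ a) '' Set.Iio n =
      LinearMap.mulLeft A c '' (w '' Set.Iio n) := by
    rw [← Set.image_comp]
    exact Set.image_congr fun i _ => ha i
  rw [h2, ← Submodule.map_span] at h1
  obtain ⟨z, hz, hz'⟩ := h1
  rw [LinearMap.mulLeft_apply, Algebra.linearMap_apply, ha] at hz'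
  rwa [← mul_left_cancel₀ hc hz']

lemma isIntegral_of_mul_pow_mem {A K : Type*} [CommRing A] [IsNoetherianRing A] [Field K]
    [Algebra A K] {c z : K} (hc : c ≠ 0) {q : ℕ → ℕ} (hq : StrictMono q)
    (h : ∀ i, ∃ a : A, algebraMap A K a = c * z ^ q i) : IsIntegral A z := by
  rcases eq_or_ne z 0 with rfl | hz
  · exact isIntegral_zero
  obtain ⟨i, hi⟩ := exists_mem_span_image_Iio hc (fun i => z ^ q i) h
  refine isIntegral_of_mem_span (pow_ne_zero _ hz) hi ?_
  rintro V - hV _ ⟨j, hj, rfl⟩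
  simp only [map_pow]
  exact pow_lt_pow_right₀ hV (hq hj)

section
variable {A K : Type*} [CommRing A] [IsNoetherianRing A] [Field K] [Algebra A K]

lemma isIntegral_pow_mul_pow_of_lt {c F : K} {y : A} (hc : c ≠ 0) {t : ℝ} {q : ℕ → ℕ}
    (hq : StrictMono q)
    (h : ∀ i, ∃ a : A, algebraMap A K a = c * (F ^ q i * algebraMap A K y ^ ⌈t * (q i : ℝ)⌉₊))
    (ht : 0 < t) {n m : ℕ} (hnm : t * n < m) :
    IsIntegral A (F ^ n * algebraMap A K y ^ m) := by
  obtain ⟨k, hk⟩ := exists_nat_gt ((n : ℝ) / (m - t * n))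
  rw [div_lt_iff₀ (by linarith)] at hk
  refine isIntegral_of_mul_pow_mem (pow_ne_zero n hc)
    (hq.comp (strictMono_id.add_const k)) fun i => ?_
  obtain ⟨a, ha⟩ := h (i + k)
  set r := q (i + k)
  have hr : k ≤ r := (Nat.le_add_left k i).trans (hq.id_le _)
  have hle : ⌈t * (r : ℝ)⌉₊ * n ≤ m * r := by
    have h1 : (⌈t * (r : ℝ)⌉₊ : ℝ) < t * r + 1 := Nat.ceil_lt_add_one (by positivity)
    have h2 : (k : ℝ) ≤ r := by exact_mod_cast hr
    have : (⌈t * (r : ℝ)⌉₊ * n : ℝ) ≤ m * r := by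
      have h3 : (k : ℝ) * (m - t * n) ≤ r * (m - t * n) :=
        mul_le_mul_of_nonneg_right h2 (by linarith)
      have h4 := mul_le_mul_of_nonneg_right h1.le (Nat.cast_nonneg (α := ℝ) n)
      nlinarith
    exact_mod_cast this
  refine ⟨a ^ n * y ^ (m * r - ⌈t * (r : ℝ)⌉₊ * n), ?_⟩
  simp only [Function.comp_apply, id]
  rw [map_mul, map_pow, ha, map_pow, mul_pow, mul_pow, mul_pow, ← pow_mul, ← pow_mul, ← pow_mul,
    ← pow_mul, mul_assoc, mul_assoc, ← pow_add, Nat.add_sub_cancel' hle, mul_comm (q (i + k)) n]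

lemma exists_isIntegral_pow_mul_pow_of_sub_le {c F : K} {y : A} (hc : c ≠ 0) (hF : F ≠ 0)
    (hy : algebraMap A K y ≠ 0) {t : ℝ} {q u : ℕ → ℕ} (hq : StrictMono q) (hu : Monotone u)
    (hqu : ∀ i j, i < j → (u j - u i : ℝ) ≤ t * (q j - q i))
    (h : ∀ i, ∃ a : A, algebraMap A K a = c * (F ^ q i * algebraMap A K y ^ u i)) :
    ∃ n m : ℕ, 0 < n ∧ (m : ℝ) ≤ t * n ∧ IsIntegral A (F ^ n * algebraMap A K y ^ m) := by
  obtain ⟨i, hi⟩ := exists_mem_span_image_Iio hc _ h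
  set Y := algebraMap A K y
  have hw0 : F ^ q i * Y ^ u i ≠ 0 := mul_ne_zero (pow_ne_zero _ hF) (pow_ne_zero _ hy)
  have hi0 : i ≠ 0 := by
    rintro rfl
    exact hw0 (by simpa using hi)
  obtain ⟨j₀, hj₀, hmax⟩ := Finset.exists_max_image (Finset.range i)
    (fun j => ((u i - u j : ℕ) : ℝ) / ((q i - q j : ℕ) : ℝ)) ⟨0, by simp; omega⟩
  rw [Finset.mem_range] at hj₀
  have hqlt : ∀ j < i, 0 < q i - q j := fun j hj => Nat.sub_pos_of_lt (hq hj)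
  refine ⟨q i - q j₀, u i - u j₀, hqlt _ hj₀, ?_, ?_⟩
  · rw [Nat.cast_sub (hu hj₀.le), Nat.cast_sub (hq hj₀).le]
    exact hqu _ _ hj₀
  refine isIntegral_of_mem_span hw0 hi ?_
  rintro V hV hlt _ ⟨j, hj, rfl⟩
  rw [Set.mem_Iio] at hj
  have hsplit : F ^ q i * Y ^ u i = (F ^ q j * Y ^ u j) * (F ^ (q i - q j) * Y ^ (u i - u j)) := by
    rw [mul_mul_mul_comm, ← pow_add, ← pow_add, Nat.add_sub_cancel' (hq hj).le,
      Nat.add_sub_cancel' (hu hj.le)]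
  have hcross : (u i - u j) * (q i - q j₀) ≤ (u i - u j₀) * (q i - q j) := by
    have := hmax j (Finset.mem_range.2 hj)
    rw [div_le_div_iff₀ (by exact_mod_cast hqlt _ hj) (by exact_mod_cast hqlt _ hj₀)] at this
    exact_mod_cast this
  have hpow : (F ^ (q i - q j₀) * Y ^ (u i - u j₀)) ^ (q i - q j) =
      (F ^ (q i - q j) * Y ^ (u i - u j)) ^ (q i - q j₀) *
        Y ^ ((u i - u j₀) * (q i - q j) - (u i - u j) * (q i - q j₀)) := by
    rw [mul_pow, mul_pow, ← pow_mul, ← pow_mul, ← pow_mul, ← pow_mul, mul_assoc, ← pow_add,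
      Nat.add_sub_cancel' hcross, mul_comm (q i - q j)]
  have h1 : 1 < V.valuation (F ^ (q i - q j) * Y ^ (u i - u j)) := by
    by_contra! hle
    have h2 := one_lt_pow₀ hlt (hqlt j hj).ne'
    rw [← map_pow, hpow, map_mul V.valuation, map_pow V.valuation, map_pow V.valuation Y] at h2
    exact h2.not_ge (mul_le_one' (pow_le_one' hle _)
      (pow_le_one' ((V.valuation_le_one_iff _).2 (hV y)) _))
  change V.valuation (F ^ q j * Y ^ u j) < _
  rw [hsplit, map_mul V.valuation (F ^ q j * Y ^ u j)]
  exact lt_mul_of_one_lt_right (zero_lt_iff.2 <| (V.valuation.ne_zero_iff).2 <|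
    mul_ne_zero (pow_ne_zero _ hF) (pow_ne_zero _ hy)) h1

lemma exists_isIntegral_pow_mul_pow_of_lt_sub {c F : K} {y : A}
    (hc : c ≠ 0) {t : ℝ} (ht : 0 < t)
    {q u : ℕ → ℕ} (hq : StrictMono q) (hu : Monotone u)
    (hstar : ∀ n m : ℕ, t * n < m → IsIntegral A (F ^ n * algebraMap A K y ^ m))
    (hu2 : ∀ i, t * q i < u i + 2)
    (hqu : ∀ i j, i < j → t * (q j - q i) < (u j - u i : ℝ))
    (h : ∀ i, ∃ a : A, algebraMap A K a = c * (F ^ q i * algebraMap A K y ^ u i)) :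
    ∃ i, IsIntegral A (F ^ q i * algebraMap A K y ^ u i) := by
  by_contra! hcon
  set Y := algebraMap A K y with hY
  choose a ha using h
  let b : Ideal A := (integralClosure A K).toSubmodule.comap
    ((LinearMap.mulLeft A c⁻¹).comp (Algebra.linearMap A K))
  have hb : ∀ z, z ∈ b ↔ IsIntegral A (c⁻¹ * algebraMap A K z) := fun z => Iff.rfl
  have hmul : ∀ i z, c⁻¹ * algebraMap A K (z * a i) =
      algebraMap A K z * (F ^ q i * Y ^ u i) := fun i z => by
    rw [map_mul, ha]; field_simp
  obtain ⟨P, φ, hP, hφ, hPb, i, s, hs, hmem⟩ := exists_prime_strictMono_mem_sup_span b a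
    fun i hi => hcon i (by
      have := (hb _).1 hi
      rwa [← one_mul (a i), hmul, map_one, one_mul] at this)
  set w := F ^ q (φ i) * Y ^ u (φ i) with hw
  let Yb : integralClosure A K := algebraMap A _ y
  have hyP : y ∈ P := by
    refine hP.mem_of_pow_mem 2 (hPb i _ ((hb _).2 ?_))
    rw [hmul, map_pow, mul_comm, mul_assoc, ← pow_add]
    exact hstar _ _ (by push_cast; exact hu2 _)
  have hspan : ∀ z ∈ span ((a ∘ φ) '' Set.Ioi i), ∃ h : integralClosure A K,
      h ∈ (span {Yb}).radical ∧ algebraMap A K z = c * (w * h) := by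
    intro z hz
    induction hz using Submodule.span_induction with
    | mem z hz =>
      obtain ⟨j, hj, rfl⟩ := hz
      have hlt := hφ (Set.mem_Ioi.1 hj)
      have hqle := (hq hlt).le
      have hule := hu hlt.le
      set n := q (φ j) - q (φ i) with hn
      set m := u (φ j) - u (φ i) with hm
      have hnm : t * n < m := by
        rw [hn, hm, Nat.cast_sub hqle, Nat.cast_sub hule]
        exact hqu _ _ hlt
      refine ⟨⟨F ^ n * Y ^ m, hstar n m hnm⟩, ?_, ?_⟩
      · obtain ⟨N, hN⟩ := exists_nat_gt (1 / (m - t * n))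
        rw [div_lt_iff₀ (by linarith)] at hN
        have h2 : t * ((n * N : ℕ) : ℝ) + 1 < (m * N : ℕ) := by push_cast; nlinarith
        have hpos : 0 < m * N := by
          have : 0 ≤ t * ((n * N : ℕ) : ℝ) := by positivity
          exact_mod_cast (by linarith : (0 : ℝ) < (m * N : ℕ))
        refine ⟨N, mem_span_singleton'.2 ⟨⟨F ^ (n * N) * Y ^ (m * N - 1), hstar _ _ ?_⟩, ?_⟩⟩
        · rw [Nat.cast_sub hpos, Nat.cast_one]
          linarith
        · refine Subtype.ext ?_
          change F ^ (n * N) * Y ^ (m * N - 1) * Y = (F ^ n * Y ^ m) ^ N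
          rw [mul_pow, ← pow_mul, ← pow_mul, mul_assoc, ← pow_succ, Nat.sub_add_cancel hpos]
      · simp only [Function.comp_apply]
        rw [ha, hw, mul_mul_mul_comm, ← pow_add, ← pow_add, hn, hm,
          Nat.add_sub_cancel' hqle, Nat.add_sub_cancel' hule]
    | zero => exact ⟨0, zero_mem _, by simp⟩
    | add x z _ _ hx hz =>
      obtain ⟨h, hh, hx⟩ := hx
      obtain ⟨k, hk, hz⟩ := hz
      exact ⟨h + k, add_mem hh hk, by rw [map_add, hx, hz]; push_cast; ring⟩
    | smul r x _ hx =>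
      obtain ⟨h, hh, hx⟩ := hx
      refine ⟨algebraMap A _ r * h, Ideal.mul_mem_left _ _ hh, ?_⟩
      rw [smul_eq_mul, map_mul, hx, MulMemClass.coe_mul]
      rw [show ((algebraMap A (integralClosure A K) r : integralClosure A K) : K)
        = algebraMap A K r from rfl]
      ring
  obtain ⟨b0, hb0, z, hz, hsum⟩ := Submodule.mem_sup.1 hmem
  obtain ⟨g, hg, hgz⟩ := hspan z hz
  let S : integralClosure A K := algebraMap A _ s
  have heq : w * (algebraMap A K s - g) = c⁻¹ * algebraMap A K b0 := by
    have h1 := hmul (φ i) s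
    rw [← hw] at h1
    rw [mul_sub, mul_comm w (algebraMap A K s), ← h1, ← hsum, map_add, hgz]
    field_simp
    ring
  by_cases hle : (span {S - g}).comap (algebraMap A (integralClosure A K)) ≤ P
  · obtain ⟨Q, hQ, hQp, hQP⟩ := Ideal.exists_ideal_over_prime_of_isIntegral P _ hle
    have hYQ : Yb ∈ Q := by rwa [← hQP] at hyP
    have hgQ : g ∈ Q := (hQp.radical_le_iff.2 ((span_singleton_le_iff_mem _).2 hYQ)) hg
    have hSQ : S ∈ Q := by
      have := Q.add_mem ((span_singleton_le_iff_mem _).1 hQ) hgQ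
      rwa [sub_add_cancel] at this
    exact hs (hQP ▸ hSQ)
  · obtain ⟨r, hr, hrP⟩ := SetLike.not_le_iff_exists.1 hle
    obtain ⟨β, hβ⟩ := Ideal.mem_span_singleton'.1 hr
    refine hrP (hPb i r ((hb _).2 ?_))
    rw [hmul, ← hw]
    have : algebraMap A K r = β * (algebraMap A K s - g) := congrArg Subtype.val hβ.symm
    rw [this, mul_assoc, mul_comm _ w, heq]
    exact β.2.mul hb0

/-- If `c F^q y^⌈tq⌉` lies in the Noetherian ring `A` for infinitely many `q`, then some
`F^n y^m` with `m ≤ tn` is integral over `A`. -/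
lemma exists_isIntegral_pow_mul_pow {c F : K} {y : A} (hc : c ≠ 0) (hF : F ≠ 0)
    (hy : algebraMap A K y ≠ 0) {t : ℝ} (ht : 0 < t) {q : ℕ → ℕ} (hq : StrictMono q)
    (h : ∀ i, ∃ a : A, algebraMap A K a = c * (F ^ q i * algebraMap A K y ^ ⌈t * (q i : ℝ)⌉₊)) :
    ∃ n m : ℕ, 0 < n ∧ (m : ℝ) ≤ t * n ∧ IsIntegral A (F ^ n * algebraMap A K y ^ m) := by
  have hmono : Monotone fun n : ℕ => ⌈t * (n : ℝ)⌉₊ := fun i j hij =>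
    Nat.ceil_mono (by gcongr)
  obtain ⟨φ, hφ | hφ⟩ := exists_increasing_or_nonincreasing_subseq (· < ·)
    fun i => (⌈t * (q i : ℝ)⌉₊ : ℝ) - t * q i
  · let r : ℕ → ℕ := fun i => q (φ (i + 1))
    have hr : StrictMono r := hq.comp (φ.strictMono.comp (strictMono_id.add_const 1))
    have hr0 : ∀ i, 0 < r i := fun i => (Nat.zero_le _).trans_lt (hq (φ.strictMono i.succ_pos))
    have hpos : ∀ i, 0 < ⌈t * (r i : ℝ)⌉₊ := fun i =>
      Nat.ceil_pos.2 (mul_pos ht (by exact_mod_cast hr0 i))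
    have hcast : ∀ i, ((⌈t * (r i : ℝ)⌉₊ - 1 : ℕ) : ℝ) = ⌈t * (r i : ℝ)⌉₊ - 1 := fun i => by
      rw [Nat.cast_sub (hpos i), Nat.cast_one]
    obtain ⟨i, hi⟩ := exists_isIntegral_pow_mul_pow_of_lt_sub (F := F) (mul_ne_zero hc hy) ht hr
      (u := fun i => ⌈t * (r i : ℝ)⌉₊ - 1)
      (fun i j hij => Nat.sub_le_sub_right (hmono (hr.monotone hij)) 1)
      (fun n m hnm => isIntegral_pow_mul_pow_of_lt hc hq h ht hnm)
      (fun i => by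
        rw [hcast]
        linarith [Nat.le_ceil (t * (r i : ℝ))])
      (fun i j hij => by
        rw [hcast, hcast]
        have := hφ (i + 1) (j + 1) (by omega)
        dsimp only [r]
        linarith)
      (fun i => by
        obtain ⟨a, ha⟩ := h (φ (i + 1))
        refine ⟨a, ?_⟩
        rw [ha, mul_assoc c, mul_left_comm (algebraMap A K y), ← pow_succ',
          Nat.sub_add_cancel (hpos i)])
    refine ⟨_, _, hr0 i, ?_, hi⟩
    rw [hcast]
    linarith [Nat.ceil_lt_add_one (a := t * (r i : ℝ)) (by positivity)]
  · refine exists_isIntegral_pow_mul_pow_of_sub_le hc hF hy (q := q ∘ φ)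
      (u := fun i => ⌈t * (q (φ i) : ℝ)⌉₊) (hq.comp φ.strictMono)
      (hmono.comp (hq.comp φ.strictMono).monotone) (fun i j hij => ?_) fun i => h _
    have := not_lt.1 (hφ i j hij)
    simp only [Function.comp_apply]
    linarith

end

lemma Ideal.exists_notMem_mul_pow_mem_of_mem_minimalPrimes {R : Type*} [CommRing R] {J Q : Ideal R}
    (hQ : Q ∈ J.minimalPrimes) {x : R} (hx : x ∈ Q) : ∃ s ∉ Q, ∃ k, s * x ^ k ∈ J := by
  have := hQ.1.1
  have h := IsLocalization.AtPrime.radical_map_of_mem_minimalPrimes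
    (Localization.AtPrime Q) Q _ hQ
  obtain ⟨k, hk⟩ := h.ge (Ideal.mem_map_of_mem _ hx)
  rw [← map_pow, IsLocalization.algebraMap_mem_map_algebraMap_iff Q.primeCompl] at hk
  obtain ⟨s, hs, h⟩ := hk
  exact ⟨s, hs, k, h⟩

lemma exists_notMem_mul_pow_mem_span_singleton {B : Type*} [CommRing B] [IsDomain B]
    [IsNoetherianRing B] {x c : B} (hc : c ≠ 0) {Q : Ideal B}
    (hQ : Q ∈ (span {x}).minimalPrimes) : ∃ s ∉ Q, ∃ k, s * x ^ k ∈ span {c} := by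
  have := hQ.1.1
  have hxQ : x ∈ Q := hQ.1.2 (mem_span_singleton_self x)
  by_cases hcQ : c ∈ Q
  swap
  · exact ⟨c, hcQ, 0, by simp⟩
  have hQc : Q ∈ (span {c}).minimalPrimes :=
    Ideal.mem_minimalPrimes_of_height_le ((span_singleton_le_iff_mem _).2 hcQ) <|
      (Ideal.height_le_one_of_isPrincipal_of_mem_minimalPrimes _ Q hQ).trans
      (Ideal.one_le_height_span_singleton_of_mem_nonZeroDivisors
        (mem_nonZeroDivisors_of_ne_zero hc))
  exact Ideal.exists_notMem_mul_pow_mem_of_mem_minimalPrimes hQc hxQ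

/-- A form of almost integrality: if `c F^q` is integral over the Noetherian ring `A` for
infinitely many `q`, then `F` is integral over `A`. -/
lemma isIntegral_of_isIntegral_mul_pow {A K : Type*} [CommRing A] [IsNoetherianRing A] [Field K]
    [Algebra A K] {c : A} (hc : algebraMap A K c ≠ 0) {F : K} {q : ℕ → ℕ} (hq : StrictMono q)
    (h : ∀ i, IsIntegral A (algebraMap A K c * F ^ q i)) : IsIntegral A F := by
  refine isIntegral_of_forall_valuationSubring fun V hV => ?_
  by_contra hFV
  have hF0 : F ≠ 0 := by
    rintro rfl
    exact hFV V.zero_mem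
  have hinv : V.valuation F⁻¹ < 1 := by
    rw [map_inv₀]
    exact inv_lt_one_of_one_lt₀ (not_le.1 fun h => hFV ((V.valuation_le_one_iff F).1 h))
  let B := Algebra.adjoin A {F⁻¹}
  have hBV : ∀ z ∈ B, z ∈ V := fun z hz => by
    induction hz using Algebra.adjoin_induction with
    | mem z hz => exact hz ▸ (V.valuation_le_one_iff _).1 hinv.le
    | algebraMap r => exact hV r
    | add _ _ _ _ h1 h2 => exact V.add_mem _ _ h1 h2
    | mul _ _ _ _ h1 h2 => exact V.mul_mem _ _ h1 h2
  have : IsNoetherianRing B := isNoetherianRing_of_fg ⟨{F⁻¹}, by simp [B]⟩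
  let x : B := ⟨F⁻¹, Algebra.subset_adjoin rfl⟩
  have hne : span {x} ≠ ⊤ := fun htop => by
    obtain ⟨y, hy⟩ := mem_span_singleton'.1 ((Ideal.eq_top_iff_one _).1 htop)
    have h1 := congrArg (fun z : B => V.valuation (z : K)) hy
    simp only [MulMemClass.coe_mul, OneMemClass.coe_one, map_mul, map_one] at h1
    exact ((mul_le_of_le_one_left' ((V.valuation_le_one_iff _).2 (hBV y y.2))).trans_lt hinv).ne h1
  obtain ⟨M, hM, hle⟩ := Ideal.exists_le_maximal _ hne
  have := hM.isPrime
  obtain ⟨Q, hQ, -⟩ := Ideal.exists_minimalPrimes_le hle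
  have hQp := hQ.1.1
  have hxQ : x ∈ Q := hQ.1.2 (mem_span_singleton_self x)
  obtain ⟨s, hs, k, hsk⟩ := exists_notMem_mul_pow_mem_span_singleton (c := algebraMap A B c)
    (fun h0 => hc (congrArg Subtype.val h0)) hQ
  obtain ⟨b, hb⟩ := mem_span_singleton'.1 hsk
  have hkq : k < q (k + 1) := hq.id_le (k + 1)
  have hb' : (s : K) * F⁻¹ ^ k = b * algebraMap A K c := congrArg Subtype.val hb.symm
  have hint : IsIntegral B ((s : K) * F ^ (q (k + 1) - k)) := by
    have heq : (s : K) * F ^ (q (k + 1) - k) = b * (algebraMap A K c * F ^ q (k + 1)) := by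
      rw [← mul_assoc, ← hb', pow_sub₀ _ hF0 hkq.le, inv_pow]
      ring
    rw [heq]
    exact (isIntegral_algebraMap (x := b)).mul ((h (k + 1)).tower_top)
  obtain ⟨Q', hQ'p, hQ'⟩ := Ideal.exists_ideal_over_prime_of_isIntegral_of_isDomain
    (S := integralClosure B K) Q fun z hz => by
      have hz0 : z = 0 := Subtype.ext (congrArg Subtype.val hz : (z : K) = 0)
      exact hz0 ▸ zero_mem Q
  refine hs ?_
  rw [← hQ', Ideal.mem_comap] at hxQ ⊢
  have : algebraMap B (integralClosure B K) s =
      ⟨_, hint⟩ * algebraMap B (integralClosure B K) x ^ (q (k + 1) - k) := by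
    refine Subtype.ext ?_
    change (s : K) = s * F ^ (q (k + 1) - k) * F⁻¹ ^ (q (k + 1) - k)
    rw [mul_assoc, ← mul_pow, mul_inv_cancel₀ hF0, one_pow, mul_one]
  rw [this]
  exact Ideal.mul_mem_left _ _ (Ideal.pow_mem_of_mem _ hxQ _ (Nat.sub_pos_of_lt hkq))

lemma Ideal.exists_notMem_mul_pow_eq_zero_of_mem_minimalPrimes {R : Type*} [CommRing R]
    {Q : Ideal R} (hQ : Q ∈ minimalPrimes R) {x : R} (hx : x ∈ Q) :
    ∃ s ∉ Q, ∃ k, s * x ^ k = 0 :=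
  Ideal.exists_notMem_mul_pow_mem_of_mem_minimalPrimes hQ hx

lemma Ideal.exists_notMem_span_mul_pow_le_of_forall {R : Type*} [CommRing R] {P J Z : Ideal R}
    [P.IsPrime] (hZ : Z.FG)
    (h : ∀ w ∈ Z, ∃ d ∉ P, ∃ M, ∀ r, d * w ^ r ∈ J ^ (r - M)) :
    ∃ d ∉ P, ∃ M, ∀ r, span {d} * Z ^ r ≤ J ^ (r - M) := by
  induction Z, hZ using Submodule.fg_induction with
  | singleton x =>
    obtain ⟨d, hd, M, hM⟩ := h x (mem_span_singleton_self x)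
    refine ⟨d, hd, M, fun r => ?_⟩
    rw [submodule_span_eq, span_singleton_pow, span_singleton_mul_span_singleton,
      span_singleton_le_iff_mem]
    exact hM r
  | sup Z₁ Z₂ _ _ h₁ h₂ =>
    obtain ⟨d₁, hd₁, M₁, hM₁⟩ := h₁ fun w hw => h w (Ideal.mem_sup_left hw)
    obtain ⟨d₂, hd₂, M₂, hM₂⟩ := h₂ fun w hw => h w (Ideal.mem_sup_right hw)
    refine ⟨d₁ * d₂, fun hd => (‹P.IsPrime›.mem_or_mem hd).elim hd₁ hd₂, M₁ + M₂, fun r => ?_⟩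
    rw [← Ideal.add_eq_sup, add_pow, Finset.mul_sum, Ideal.sum_eq_sup]
    refine Finset.sup_le fun i hi => ?_
    rw [Finset.mem_range] at hi
    rw [← span_singleton_mul_span_singleton, ← mul_assoc, mul_mul_mul_comm]
    refine Ideal.mul_le_left.trans ((Ideal.mul_mono (hM₁ i) (hM₂ (r - i))).trans ?_)
    rw [← pow_add]
    exact Ideal.pow_le_pow_right (by omega)

lemma Ideal.sup_span_singleton_pow_succ_le {R : Type*} [CommRing R] (J : Ideal R) (z : R) (l : ℕ) :
    (J ⊔ span {z}) ^ (l + 1) ≤ span {z ^ (l + 1)} ⊔ J * (J ⊔ span {z}) ^ l := by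
  induction l with
  | zero => simp [sup_comm]
  | succ l ih =>
    set W := J ⊔ span {z}
    rw [pow_succ W, show W ^ (l + 1) * W = W ^ (l + 1) * J ⊔ W ^ (l + 1) * span {z} from
      Ideal.mul_sup ..]
    refine sup_le ?_ ?_
    · rw [mul_comm]
      exact le_sup_right
    · refine (Ideal.mul_mono_left ih).trans ?_
      rw [Ideal.sup_mul, span_singleton_mul_span_singleton, ← pow_succ, mul_assoc, pow_succ W]
      exact sup_le_sup_left (Ideal.mul_mono_right (Ideal.mul_mono_right le_sup_right)) _

lemma Ideal.mul_pow_mem_pow_sub {R : Type*} [CommRing R] {J : Ideal R} {d g z : R} {M k : ℕ}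
    (hM : 0 < M) (hg : g - z ^ M ∈ J * (J ⊔ span {z}) ^ (M - 1)) (hd : d * g ^ k = 0) (r : ℕ) :
    d * z ^ r ∈ J ^ (r - M * k) := by
  rcases Nat.eq_zero_or_pos k with rfl | hk
  · have : d = 0 := by simpa using hd
    simp [this]
  set W := J ⊔ span {z} with hW
  have hz : z ∈ W := Ideal.mem_sup_right (mem_span_singleton_self z)
  have hgW : g ∈ W ^ M := by
    have h1 : g - z ^ M ∈ W ^ M := by
      refine (Ideal.mul_mono_left le_sup_left : _ ≤ W * W ^ (M - 1)) hg |> fun h => ?_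
      rwa [← pow_succ', Nat.sub_add_cancel hM] at h
    simpa using add_mem h1 (Ideal.pow_mem_pow hz M)
  have hpow : ∀ k, g ^ k - z ^ (M * k) ∈ J * W ^ (M * k - 1) := by
    intro k
    induction k with
    | zero => simp
    | succ k ih =>
      have h1 : g ^ (k + 1) - z ^ (M * (k + 1)) =
          (g - z ^ M) * g ^ k + (g ^ k - z ^ (M * k)) * z ^ M := by ring
      rw [h1]
      refine add_mem ?_ ?_
      · have := Ideal.mul_mem_mul hg (Ideal.pow_mem_pow hgW k)
        rwa [mul_assoc, ← pow_mul, ← pow_add,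
          show M - 1 + M * k = M * (k + 1) - 1 by rw [mul_add]; omega] at this
      · rcases Nat.eq_zero_or_pos k with rfl | hk
        · simp
        · have := Ideal.mul_mem_mul ih (Ideal.pow_mem_pow hz M)
          have h2 : 0 < M * k := Nat.mul_pos hM hk
          rwa [mul_assoc, ← pow_add,
            show M * k - 1 + M = M * (k + 1) - 1 by rw [mul_add]; omega] at this
  obtain ⟨l, hl⟩ : ∃ l, M * k = l + 1 := ⟨M * k - 1, by have := Nat.mul_pos hM hk; omega⟩
  have hbase : span {d} * W ^ (l + 1) ≤ span {d} * (J * W ^ l) := by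
    refine (Ideal.mul_mono_right (Ideal.sup_span_singleton_pow_succ_le J z l)).trans ?_
    rw [Ideal.mul_sup, span_singleton_mul_span_singleton]
    refine sup_le ((span_singleton_le_iff_mem _).2 ?_) le_rfl
    rw [mem_span_singleton_mul]
    refine ⟨-(g ^ k - z ^ (M * k)), neg_mem (by simpa [hl] using hpow k), ?_⟩
    rw [hl]
    linear_combination -hd
  have hstep : ∀ s, span {d} * W ^ (l + s) ≤ J ^ s * (span {d} * W ^ l) := by
    intro s
    induction s with
    | zero => simp
    | succ s ih =>
      calc span {d} * W ^ (l + (s + 1)) = span {d} * W ^ (l + 1) * W ^ s := by ring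
        _ ≤ span {d} * (J * W ^ l) * W ^ s := Ideal.mul_mono_left hbase
        _ = J * (span {d} * W ^ (l + s)) := by ring
        _ ≤ J * (J ^ s * (span {d} * W ^ l)) := Ideal.mul_mono_right ih
        _ = J ^ (s + 1) * (span {d} * W ^ l) := by ring
  rw [hl]
  rcases le_total r (l + 1) with hr | hr
  · simp [Nat.sub_eq_zero_of_le hr]
  have hmem : d * z ^ r ∈ J ^ (r - l) * (span {d} * W ^ l) := hstep (r - l) <| by
    rw [Nat.add_sub_cancel' (by omega)]
    exact Ideal.mul_mem_mul (mem_span_singleton_self d) (Ideal.pow_mem_pow hz r)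
  exact Ideal.pow_le_pow_right (by omega) (Ideal.mul_le_left hmem)

/-- Elements outside each minimal prime lying in all but finitely many `S n` can be replaced
by a single one, by prime avoidance. -/
lemma exists_mem_Rcirc_of_forall_minimalPrimes {R : Type*} [CommRing R] [IsNoetherianRing R]
    (S : ℕ → Ideal R) (h : ∀ P ∈ minimalPrimes R, ∃ c ∉ P, ∃ N, ∀ n, N ≤ n → c ∈ S n) :
    ∃ c ∈ Rcirc R, ∃ N, ∀ n, N ≤ n → c ∈ S n := by
  choose! c hc N hN using h
  have hfin := minimalPrimes.finite_of_isNoetherianRing R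
  obtain ⟨N₀, hN₀⟩ := (hfin.image N).bddAbove
  have hsub : ¬ (((⨅ n, ⨅ _ : N₀ ≤ n, S n : Ideal R) : Set R) ⊆
      ⋃ P ∈ minimalPrimes R, (P : Set R)) := by
    intro hsub
    obtain ⟨P, hP, hle⟩ :=
      (Ideal.subset_union_prime_finite hfin (f := id) 0 0 fun P hP _ _ => hP.1.1).1 hsub
    refine hc P hP (hle ?_)
    simp only [Submodule.mem_iInf]
    exact fun n hn => hN P hP n ((hN₀ ⟨P, hP, rfl⟩).trans hn)
  obtain ⟨d, hd, hdP⟩ := Set.not_subset.1 hsub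
  refine ⟨d, fun P hP hmem => hdP (Set.mem_biUnion hP hmem), N₀, ?_⟩
  simpa only [SetLike.mem_coe, Submodule.mem_iInf] using hd

open Polynomial

section
variable {R : Type*} [CommRing R] (P I : Ideal R)

/-- The Rees algebra of the image of `I` in `R ⧸ P`. -/
abbrev ReesQuotient := reesAlgebra (I.map (Ideal.Quotient.mk P))

/-- The image of `z Xⁿ` in the fraction field of `(R ⧸ P)[X]`. -/
noncomputable def reesMonomial [P.IsPrime] (n : ℕ) (z : R) : FractionRing (R ⧸ P)[X] :=
  algebraMap (R ⧸ P)[X] _ (monomial n (Ideal.Quotient.mk P z))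

variable [P.IsPrime]

lemma reesMonomial_mul (m n : ℕ) (x y : R) :
    reesMonomial P m x * reesMonomial P n y = reesMonomial P (m + n) (x * y) := by
  rw [reesMonomial, reesMonomial, reesMonomial, ← map_mul, monomial_mul_monomial,
    map_mul (Ideal.Quotient.mk P)]

lemma reesMonomial_pow (m n : ℕ) (x : R) :
    reesMonomial P m x ^ n = reesMonomial P (m * n) (x ^ n) := by
  rw [reesMonomial, reesMonomial, ← map_pow, monomial_pow, map_pow (Ideal.Quotient.mk P)]

lemma reesMonomial_eq_zero_iff (n : ℕ) (x : R) : reesMonomial P n x = 0 ↔ x ∈ P := by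
  rw [reesMonomial, IsFractionRing.to_map_eq_zero_iff, monomial_eq_zero_iff,
    Ideal.Quotient.eq_zero_iff_mem]

lemma reesMonomial_add (n : ℕ) (x y : R) :
    reesMonomial P n (x + y) = reesMonomial P n x + reesMonomial P n y := by
  simp only [reesMonomial, map_add]

lemma exists_algebraMap_eq_reesMonomial {n : ℕ} {x : R} (hx : x ∈ I ^ n) :
    ∃ a : ReesQuotient P I, algebraMap _ (FractionRing (R ⧸ P)[X]) a = reesMonomial P n x := by
  refine ⟨⟨_, reesAlgebra.monomial_mem.2 ?_⟩, rfl⟩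
  rw [← Ideal.map_pow]
  exact Ideal.mem_map_of_mem _ hx

lemma exists_sub_pow_mem_of_isIntegral {n : ℕ} {z : R}
    (h : IsIntegral (ReesQuotient P I) (reesMonomial P n z)) :
    ∃ M > 0, ∃ g ∈ P, g - z ^ M ∈ I ^ n * (I ^ n ⊔ span {z}) ^ (M - 1) := by
  obtain ⟨f, hf, hfz⟩ := h
  have h1 : (monomial n (Ideal.Quotient.mk P z)) ^ f.natDegree +
      ∑ i ∈ Finset.range f.natDegree,
        (f.coeff i : (R ⧸ P)[X]) * (monomial n (Ideal.Quotient.mk P z)) ^ i = 0 := by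
    apply IsFractionRing.injective (R ⧸ P)[X] (FractionRing (R ⧸ P)[X])
    rw [eval₂_eq_sum_range, Finset.sum_range_succ, hf.coeff_natDegree, map_one, one_mul] at hfz
    rw [map_zero, ← hfz, map_add, map_sum, add_comm]
    simp only [map_mul, map_pow]
    rfl
  set M := f.natDegree
  have h2 : ∀ i < M, ∃ b ∈ (I ^ n) ^ (M - i),
      Ideal.Quotient.mk P b = (f.coeff i : (R ⧸ P)[X]).coeff (n * (M - i)) := fun i _ => by
    have := (mem_reesAlgebra_iff _ _).1 (f.coeff i).2 (n * (M - i))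
    rw [← Ideal.map_pow, Ideal.mem_map_iff_of_surjective _ Ideal.Quotient.mk_surjective,
      pow_mul] at this
    exact this
  choose! b hb hbf using h2
  have h3 : z ^ M + ∑ i ∈ Finset.range M, b i * z ^ i ∈ P := by
    have h4 := congrArg (fun p => coeff p (n * M)) h1
    simp only [coeff_add, finsetSum_coeff, monomial_pow, coeff_monomial_same, coeff_zero] at h4
    rw [← Ideal.Quotient.eq_zero_iff_mem, ← h4, map_add, map_pow, map_sum]
    congr 1
    refine Finset.sum_congr rfl fun i hi => ?_
    have hi := Finset.mem_range.1 hi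
    rw [map_mul, map_pow, hbf i hi]
    rw [show n * M = n * (M - i) + n * i by rw [← mul_add, Nat.sub_add_cancel hi.le],
      coeff_mul_monomial]
  have hM : 0 < M := Nat.pos_of_ne_zero fun h0 => by
    rw [h0] at h3
    exact ‹P.IsPrime›.ne_top ((Ideal.eq_top_iff_one _).2 (by simpa using h3))
  refine ⟨M, hM, _, h3, ?_⟩
  rw [add_sub_cancel_left]
  refine Ideal.sum_mem _ fun i hi => ?_
  have hi := Finset.mem_range.1 hi
  have h5 := Ideal.mul_mem_mul (hb i hi) (Ideal.pow_mem_pow (mem_span_singleton_self z) i)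
  refine (?_ : (I ^ n) ^ (M - i) * span {z} ^ i ≤ _) h5
  rw [show M - i = (M - 1 - i) + 1 by omega, pow_succ', mul_assoc]
  refine Ideal.mul_mono_right ?_
  calc _ ≤ (I ^ n ⊔ span {z}) ^ (M - 1 - i) * (I ^ n ⊔ span {z}) ^ i :=
        Ideal.mul_mono (Ideal.pow_right_mono le_sup_left _) (Ideal.pow_right_mono le_sup_right _)
    _ = _ := by rw [← pow_add, Nat.sub_add_cancel (by omega)]

variable {P} in
lemma exists_mul_pow_mem_of_isIntegral (hP : P ∈ minimalPrimes R) {n : ℕ} {z : R}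
    (h : IsIntegral (ReesQuotient P I) (reesMonomial P n z)) :
    ∃ d ∉ P, ∃ M, ∀ r, d * z ^ r ∈ (I ^ n) ^ (r - M) := by
  obtain ⟨M, hM, g, hg, hgz⟩ := exists_sub_pow_mem_of_isIntegral P I h
  obtain ⟨d, hd, k, hk⟩ := Ideal.exists_notMem_mul_pow_eq_zero_of_mem_minimalPrimes hP hg
  exact ⟨d, hd, _, Ideal.mul_pow_mem_pow_sub hM hgz hk⟩

end

section
variable {R : Type*} [CommRing R] [IsNoetherianRing R] {P I a : Ideal R} {c x : R} {t : ℝ}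

lemma exists_notMem_forall_mul_eq_zero (hP : P ∈ minimalPrimes R) (ha : a ≤ P) :
    ∃ d ∉ P, ∃ k, ∀ n, k ≤ n → ∀ y ∈ a ^ n, d * y = 0 := by
  have := hP.1.1
  obtain ⟨d, hd, M, h⟩ := Ideal.exists_notMem_span_mul_pow_le_of_forall (P := P) (Z := a) (J := ⊥)
    (IsNoetherian.noetherian a) fun w hw => by
      obtain ⟨s, hs, k, hk⟩ :=
        Ideal.exists_notMem_mul_pow_eq_zero_of_mem_minimalPrimes hP (ha hw)
      refine ⟨s, hs, k, fun r => ?_⟩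
      rcases le_total r k with hr | hr
      · simp [Nat.sub_eq_zero_of_le hr]
      · rw [← Nat.add_sub_cancel' hr, pow_add, ← mul_assoc, hk, zero_mul]
        exact Ideal.zero_mem _
  refine ⟨d, hd, M + 1, fun n hn y hy => ?_⟩
  have hmem := h n (Ideal.mul_mem_mul (mem_span_singleton_self d) hy)
  rw [← Ideal.zero_eq_bot, zero_pow (by omega)] at hmem
  exact hmem

lemma exists_notMem_mul_pow_mul_eq_zero (hP : P ∈ minimalPrimes R) (ht : 0 < t)
    (h : x ∈ P ∨ a ≤ P) :
    ∃ d ∉ P, ∃ N, ∀ n : ℕ, N ≤ n → ∀ y ∈ a ^ ⌈t * (n : ℝ)⌉₊, d * x ^ n * y = 0 := by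
  rcases h with hx | ha
  · obtain ⟨d, hd, k, hk⟩ := Ideal.exists_notMem_mul_pow_eq_zero_of_mem_minimalPrimes hP hx
    refine ⟨d, hd, k, fun n hn y _ => ?_⟩
    rw [← Nat.add_sub_cancel' hn, pow_add, ← mul_assoc, hk, zero_mul, zero_mul]
  · obtain ⟨d, hd, k, hk⟩ := exists_notMem_forall_mul_eq_zero hP ha
    refine ⟨d, hd, ⌈k / t⌉₊, fun n hn y hy => ?_⟩
    have hn' : (k : ℝ) ≤ t * n := by
      have := (div_le_iff₀' ht).1 (Nat.ceil_le.1 hn)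
      exact this
    have hkn : k ≤ ⌈t * (n : ℝ)⌉₊ := by exact_mod_cast hn'.trans (Nat.le_ceil _)
    rw [mul_right_comm, hk _ hkn y hy, zero_mul]

end

section
variable {R : Type*} [CommRing R] {P I a : Ideal R} [P.IsPrime] {c x : R}

lemma not_le_of_forall_mul_pow_mem (hc : c ∉ P) (hx : x ∉ P) (ha : ¬ a ≤ P) {q u : ℕ}
    (hq : q ≠ 0) (h : ∀ y ∈ a ^ u, c * x ^ q * y ∈ I ^ q) : ¬ I ≤ P := by
  intro hI
  obtain ⟨y, hy, hyP⟩ := Set.not_subset.1 ha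
  have h1 := ((Ideal.pow_le_self hq).trans hI) (h _ (Ideal.pow_mem_pow hy u))
  rcases ‹P.IsPrime›.mem_or_mem h1 with h2 | h2
  · rcases ‹P.IsPrime›.mem_or_mem h2 with h3 | h3
    · exact hc h3
    · exact hx (‹P.IsPrime›.mem_of_pow_mem _ h3)
  · exact hyP (‹P.IsPrime›.mem_of_pow_mem _ h2)

variable {V : ValuationSubring (FractionRing (R ⧸ P)[X])}

lemma reesMonomial_mem_of_forall_mem
    (hV : ∀ b : ReesQuotient P I, algebraMap _ (FractionRing (R ⧸ P)[X]) b ∈ V) {n : ℕ} {z : R}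
    (hz : z ∈ I ^ n) : reesMonomial P n z ∈ V := by
  obtain ⟨b, hb⟩ := exists_algebraMap_eq_reesMonomial P I hz
  exact hb ▸ hV b

lemma reesMonomial_zero_mem_of_forall_mem
    (hV : ∀ b : ReesQuotient P I, algebraMap _ (FractionRing (R ⧸ P)[X]) b ∈ V) (z : R) :
    reesMonomial P 0 z ∈ V :=
  reesMonomial_mem_of_forall_mem hV (n := 0) (by simp)

lemma exists_forall_valuation_reesMonomial_le
    (hV : ∀ b : ReesQuotient P I, algebraMap _ (FractionRing (R ⧸ P)[X]) b ∈ V)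
    {T : Finset R} (hT : T.Nonempty) :
    ∃ z ∈ T, ∀ y ∈ span (T : Set R),
      V.valuation (reesMonomial P 0 y) ≤ V.valuation (reesMonomial P 0 z) := by
  obtain ⟨z, hz, hmax⟩ := T.exists_max_image (fun y => V.valuation (reesMonomial P 0 y)) hT
  refine ⟨z, hz, fun y hy => ?_⟩
  induction hy using Submodule.span_induction with
  | mem y hy => exact hmax y hy
  | zero => simp [reesMonomial]
  | add y₁ y₂ _ _ h₁ h₂ =>
    rw [reesMonomial_add]
    exact V.valuation.map_add_le h₁ h₂
  | smul r y _ h =>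
    rw [smul_eq_mul, ← zero_add 0, ← reesMonomial_mul, map_mul]
    exact (mul_le_of_le_one_left' ((V.valuation_le_one_iff _).2
      (reesMonomial_zero_mem_of_forall_mem hV r))).trans h

lemma valuation_reesMonomial_le_of_mem_pow
    (hV : ∀ b : ReesQuotient P I, algebraMap _ (FractionRing (R ⧸ P)[X]) b ∈ V)
    {γ : V.ValueGroup} (h : ∀ y ∈ a, V.valuation (reesMonomial P 0 y) ≤ γ) (m : ℕ) :
    ∀ z ∈ a ^ m, V.valuation (reesMonomial P 0 z) ≤ γ ^ m := by
  induction m with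
  | zero =>
    intro z _
    rw [pow_zero]
    exact (V.valuation_le_one_iff _).2 (reesMonomial_zero_mem_of_forall_mem hV z)
  | succ m ih =>
    intro z hz
    rw [pow_succ] at hz
    induction hz using Submodule.mul_induction_on' with
    | mem_mul_mem y₁ h₁ y₂ h₂ =>
      rw [← zero_add 0, ← reesMonomial_mul, map_mul, pow_succ]
      exact mul_le_mul' (ih _ h₁) (h _ h₂)
    | add y₁ _ y₂ _ h₁ h₂ =>
      rw [reesMonomial_add]
      exact V.valuation.map_add_le h₁ h₂

end

lemma exists_forall_isIntegral_pow_mul_pow {ι A K : Type*} [CommRing A] [CommRing K] [Algebra A K]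
    {g : ι → K} (hg : ∀ i, IsIntegral A (g i)) {F : K} {t : ℝ} (T : Finset ι)
    (h : ∀ i ∈ T, ∃ n m : ℕ, 0 < n ∧ (m : ℝ) ≤ t * n ∧ IsIntegral A (F ^ n * g i ^ m))
    (ht : 0 < t) :
    ∃ n m : ℕ, 0 < n ∧ (m : ℝ) ≤ t * n ∧ ∀ i ∈ T, IsIntegral A (F ^ n * g i ^ m) := by
  classical
  induction T using Finset.induction_on with
  | empty => exact ⟨1, 0, one_pos, by simpa using ht.le, by simp⟩
  | insert j T _ ih =>
    obtain ⟨n₁, m₁, hn₁, hm₁, h₁⟩ := h j (Finset.mem_insert_self _ _)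
    obtain ⟨n₂, m₂, hn₂, hm₂, h₂⟩ := ih fun i hi => h i (Finset.mem_insert_of_mem hi)
    have key : ∀ {i : ι} {n m k l : ℕ}, m * k ≤ l → IsIntegral A (F ^ n * g i ^ m) →
        IsIntegral A (F ^ (n * k) * g i ^ l) := fun {i n m k l} hl hi => by
      have := (hi.pow k).mul ((hg i).pow (l - m * k))
      rwa [mul_pow, ← pow_mul, ← pow_mul, mul_assoc, ← pow_add, Nat.add_sub_cancel' hl] at this
    refine ⟨n₁ * n₂, max (m₁ * n₂) (m₂ * n₁), by positivity, ?_, fun i hi => ?_⟩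
    · push_cast
      refine max_le ?_ ?_
      · rw [← mul_assoc]; gcongr
      · rw [mul_comm (n₁ : ℝ), ← mul_assoc]; gcongr
    · rcases Finset.mem_insert.1 hi with rfl | hi
      · exact key (le_max_left _ _) h₁
      · rw [mul_comm n₁]
        exact key (le_max_right _ _) (h₂ i hi)

section
variable {R : Type*} [CommRing R] [IsNoetherianRing R] {P I a : Ideal R} [P.IsPrime] {c x : R}
  {t : ℝ}

lemma exists_isIntegral_reesMonomial (ht : 0 < t) (hc : c ∉ P) (hx : x ∉ P) (ha : ¬ a ≤ P)
    {q : ℕ → ℕ} (hq : StrictMono q)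
    (h : ∀ i, ∀ y ∈ a ^ ⌈t * (q i : ℝ)⌉₊, c * x ^ q i * y ∈ I ^ q i) :
    ∃ N m : ℕ, 0 < N ∧ (m : ℝ) ≤ t * N ∧
      ∀ z ∈ a ^ m, IsIntegral (ReesQuotient P I) (reesMonomial P N (x ^ N * z)) := by
  obtain ⟨T, rfl⟩ := IsNoetherian.noetherian a
  have hT : T.Nonempty := by
    rw [Finset.nonempty_iff_ne_empty]
    rintro rfl
    simp at ha
  have hψ : ∀ y : R, ∃ b : ReesQuotient P I,
      algebraMap _ (FractionRing (R ⧸ P)[X]) b = reesMonomial P 0 y := fun y =>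
    exists_algebraMap_eq_reesMonomial P I (by simp)
  have hψi : ∀ y : R, IsIntegral (ReesQuotient P I) (reesMonomial P 0 y) := fun y => by
    obtain ⟨b, hb⟩ := hψ y
    exact hb ▸ isIntegral_algebraMap
  obtain ⟨N, m, hN, hm, hint⟩ := exists_forall_isIntegral_pow_mul_pow (F := reesMonomial P 1 x)
    (t := t) hψi T (fun y hy => by
      by_cases hyP : y ∈ P
      · have h0 := (reesMonomial_eq_zero_iff P 0 y).2 hyP
        refine ⟨⌈1 / t⌉₊, 1, Nat.ceil_pos.2 (by positivity), ?_, ?_⟩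
        · rw [Nat.cast_one]
          exact (div_le_iff₀' ht).1 (Nat.le_ceil _)
        · rw [h0, pow_one, mul_zero]
          exact isIntegral_zero
      obtain ⟨b, hb⟩ := hψ y
      rw [← hb]
      refine exists_isIntegral_pow_mul_pow (c := reesMonomial P 0 c)
        (mt (reesMonomial_eq_zero_iff P 0 c).1 hc) (mt (reesMonomial_eq_zero_iff P 1 x).1 hx)
        (hb ▸ mt (reesMonomial_eq_zero_iff P 0 y).1 hyP) ht hq fun i => ?_
      obtain ⟨b', hb'⟩ := exists_algebraMap_eq_reesMonomial P I
        (h i _ (Ideal.pow_mem_pow (Ideal.subset_span hy) _))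
      refine ⟨b', ?_⟩
      rw [hb', hb, reesMonomial_pow, reesMonomial_pow, reesMonomial_mul, reesMonomial_mul]
      simp [mul_assoc]) ht
  refine ⟨N, m, hN, hm, fun z hz => isIntegral_of_forall_valuationSubring fun V hV => ?_⟩
  obtain ⟨y, hy, hmax⟩ := exists_forall_valuation_reesMonomial_le hV hT
  have h1 := valuation_reesMonomial_le_of_mem_pow hV hmax m z hz
  have h2 := (V.valuation_le_one_iff _).2 (mem_valuationSubring_of_isIntegral (hint y hy) V hV)
  rw [← V.valuation_le_one_iff]
  refine le_trans ?_ h2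
  rw [show reesMonomial P N (x ^ N * z) = reesMonomial P 1 x ^ N * reesMonomial P 0 z by
    rw [reesMonomial_pow, reesMonomial_mul, one_mul, add_zero], map_mul, map_mul, map_pow _ _ m]
  exact mul_le_mul_right h1 _

lemma exists_notMem_forall_mul_pow_mul_mem (hP : P ∈ minimalPrimes R) (ht : 0 < t) (hc : c ∉ P)
    (hx : x ∉ P) (ha : ¬ a ≤ P) (hI : ¬ I ≤ P) {q : ℕ → ℕ} (hq : StrictMono q)
    (h : ∀ i, ∀ y ∈ a ^ ⌈t * (q i : ℝ)⌉₊, c * x ^ q i * y ∈ I ^ q i) :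
    ∃ d ∉ P, ∀ n : ℕ, ∀ y ∈ a ^ ⌈t * (n : ℝ)⌉₊, d * x ^ n * y ∈ I ^ n := by
  obtain ⟨N, m, hN, hm, hint⟩ := exists_isIntegral_reesMonomial ht hc hx ha hq h
  obtain ⟨d, hd, M, hdM⟩ := Ideal.exists_notMem_span_mul_pow_le_of_forall (P := P)
    (Z := span {x ^ N} * a ^ m) (J := I ^ N) (IsNoetherian.noetherian _) fun w hw => by
      obtain ⟨z, hz, rfl⟩ := mem_span_singleton_mul.1 hw
      exact exists_mul_pow_mem_of_isIntegral I hP (hint z hz)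
  obtain ⟨b, hb, hbP⟩ := Set.not_subset.1 hI
  refine ⟨d * b ^ (N * (M + 1)), fun hmem => (‹P.IsPrime›.mem_or_mem hmem).elim hd
    fun hmem => hbP (‹P.IsPrime›.mem_of_pow_mem _ hmem), fun n y hy => ?_⟩
  set r := n / N
  have hnr : N * r ≤ n := Nat.mul_div_le n N
  have hmr : m * r ≤ ⌈t * (n : ℝ)⌉₊ := by
    have h1 : ((m * r : ℕ) : ℝ) ≤ t * n := by
      push_cast
      calc (m : ℝ) * r ≤ t * N * r := by gcongr
        _ = t * ((N * r : ℕ) : ℝ) := by push_cast; ring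
        _ ≤ t * n := by gcongr
    exact_mod_cast h1.trans (Nat.le_ceil _)
  have h1 : d * (x ^ (N * r) * y) ∈ (I ^ N) ^ (r - M) := by
    refine hdM r (Ideal.mul_mem_mul (mem_span_singleton_self d) ?_)
    rw [mul_pow, ← pow_mul, pow_mul x]
    exact Ideal.mul_mem_mul (Ideal.pow_mem_pow (mem_span_singleton_self _) r)
      (Ideal.pow_le_pow_right hmr hy)
  have h2 := Ideal.mul_mem_left _ (x ^ (n - N * r))
    (Ideal.mul_mem_mul h1 (Ideal.pow_mem_pow hb (N * (M + 1))))
  rw [← pow_mul, ← pow_add, ← mul_add] at h2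
  have h3 : n ≤ N * (r - M + (M + 1)) := by
    have : n < N * (r + 1) := Nat.lt_mul_div_succ n hN
    exact this.le.trans (Nat.mul_le_mul_left _ (by omega))
  convert Ideal.pow_le_pow_right h3 h2 using 1
  rw [← Nat.add_sub_cancel' hnr, pow_add]
  simp only [Nat.add_sub_cancel_left]
  ring

lemma isIntegral_reesMonomial_of_forall_mul_mem_mul {u q : ℕ} (ha : ¬ a ≤ P)
    (h : ∀ y ∈ a ^ u, c * x ^ q * y ∈ a ^ u * I ^ q) :
    IsIntegral (ReesQuotient P I) (reesMonomial P q (c * x ^ q)) := by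
  obtain ⟨y₀, hy₀, hy₀P⟩ := Set.not_subset.1 ha
  obtain ⟨T, hT⟩ := IsNoetherian.noetherian (a ^ u)
  replace hT : span (T : Set R) = a ^ u := hT
  have hu : y₀ ^ u ∈ span (T : Set R) := hT ▸ Ideal.pow_mem_pow hy₀ u
  have hu0 : reesMonomial P 0 (y₀ ^ u) ≠ 0 :=
    mt (reesMonomial_eq_zero_iff P 0 _).1 fun h => hy₀P (‹P.IsPrime›.mem_of_pow_mem _ h)
  have hTne : T.Nonempty := by
    rw [Finset.nonempty_iff_ne_empty]
    rintro rfl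
    have : y₀ ^ u = 0 := by simpa using hu
    exact hu0 (by simp [reesMonomial, this])
  refine isIntegral_of_forall_valuationSubring fun V hV => ?_
  obtain ⟨z, hz, hmax⟩ := exists_forall_valuation_reesMonomial_le hV hTne
  have hz0 : 0 < V.valuation (reesMonomial P 0 z) :=
    (zero_lt_iff.2 ((Valuation.ne_zero_iff _).2 hu0)).trans_le (hmax _ hu)
  have hle : ∀ w ∈ a ^ u * I ^ q,
      V.valuation (reesMonomial P q w) ≤ V.valuation (reesMonomial P 0 z) := fun w hw => by
    induction hw using Submodule.mul_induction_on' with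
    | mem_mul_mem y₁ h₁ y₂ h₂ =>
      rw [← zero_add q, ← reesMonomial_mul, map_mul]
      exact (mul_le_of_le_one_right' ((V.valuation_le_one_iff _).2
        (reesMonomial_mem_of_forall_mem hV h₂))).trans (hmax _ (hT ▸ h₁))
    | add y₁ _ y₂ _ h₁ h₂ =>
      rw [reesMonomial_add]
      exact V.valuation.map_add_le h₁ h₂
  have h1 := hle _ (h z (hT ▸ Ideal.subset_span hz))
  rw [← add_zero q, ← reesMonomial_mul, map_mul] at h1
  rw [← V.valuation_le_one_iff]
  exact (mul_le_iff_le_one_left hz0).1 h1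

lemma exists_notMem_forall_mul_pow_mem (hP : P ∈ minimalPrimes R) (hc : c ∉ P)
    (ha : ¬ a ≤ P) (hI : ¬ I ≤ P) {q u : ℕ → ℕ} (hq : StrictMono q)
    (h : ∀ i, ∀ y ∈ a ^ u i, c * x ^ q i * y ∈ a ^ u i * I ^ q i) :
    ∃ d ∉ P, ∀ n, d * x ^ n ∈ I ^ n := by
  obtain ⟨b', hb'⟩ := exists_algebraMap_eq_reesMonomial P I (n := 0) (x := c) (by simp)
  have hF : IsIntegral (ReesQuotient P I) (reesMonomial P 1 x) := by
    refine isIntegral_of_isIntegral_mul_pow (c := b')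
      (hb' ▸ mt (reesMonomial_eq_zero_iff P 0 c).1 hc) hq fun i => ?_
    rw [hb', reesMonomial_pow, reesMonomial_mul, one_mul, zero_add]
    exact isIntegral_reesMonomial_of_forall_mul_mem_mul ha (h i)
  obtain ⟨d, hd, M, hdM⟩ := exists_mul_pow_mem_of_isIntegral I hP hF
  obtain ⟨b, hb, hbP⟩ := Set.not_subset.1 hI
  refine ⟨d * b ^ M, fun hmem => (‹P.IsPrime›.mem_or_mem hmem).elim hd
    fun hmem => hbP (‹P.IsPrime›.mem_of_pow_mem _ hmem), fun n => ?_⟩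
  have h1 := Ideal.mul_mem_mul (hdM n) (Ideal.pow_mem_pow hb M)
  rw [pow_one, ← pow_add, mul_right_comm] at h1
  exact Ideal.pow_le_pow_right (by omega) h1

end

lemma fbp_le_pow {R : Type*} [CommRing R] (I : Ideal R) (q : ℕ) : fbp I q ≤ I ^ q := by
  rw [fbp, span_le]
  rintro _ ⟨y, hy, rfl⟩
  exact Ideal.pow_mem_pow hy q

lemma exists_mem_Rcirc_forall_mul_pow_mul_mem {R : Type*} [CommRing R] [IsNoetherianRing R]
    {a : Ideal R} {x : R} {t : ℝ} (ht : 0 < t) (J : ℕ → Ideal R)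
    (h : ∀ P ∈ minimalPrimes R, x ∉ P → ¬ a ≤ P →
      ∃ d ∉ P, ∀ n : ℕ, ∀ y ∈ a ^ ⌈t * (n : ℝ)⌉₊, d * x ^ n * y ∈ J n) :
    ∃ d ∈ Rcirc R, ∃ N : ℕ, ∀ n : ℕ, N ≤ n →
      ∀ y ∈ a ^ ⌈t * (n : ℝ)⌉₊, d * x ^ n * y ∈ J n := by
  have hmem : ∀ d n, d ∈ (J n).colon ((span {x ^ n} * a ^ ⌈t * (n : ℝ)⌉₊ : Ideal R) : Set R) ↔
      ∀ y ∈ a ^ ⌈t * (n : ℝ)⌉₊, d * x ^ n * y ∈ J n := fun d n => by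
    simp only [Submodule.mem_colon, SetLike.mem_coe, mem_span_singleton_mul,
      forall_exists_index, and_imp, forall_apply_eq_imp_iff₂, smul_eq_mul, ← mul_assoc]
  simp only [← hmem]
  refine exists_mem_Rcirc_of_forall_minimalPrimes _ fun P hP => ?_
  simp only [hmem]
  by_cases hxa : x ∈ P ∨ a ≤ P
  · obtain ⟨d, hd, N, hN⟩ := exists_notMem_mul_pow_mul_eq_zero hP ht hxa
    exact ⟨d, hd, N, fun n hn y hy => hN n hn y hy ▸ Ideal.zero_mem _⟩
  · rw [not_or] at hxa
    obtain ⟨d, hd, hdn⟩ := h P hP hxa.1 hxa.2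
    exact ⟨d, hd, 0, fun n _ => hdn n⟩

theorem adjusted_tight_le_adjusted_integral {R : Type*} [CommRing R] [IsNoetherianRing R]
    (p : ℕ) [Fact p.Prime] [CharP R p] (I a : Ideal R) (t : ℝ) (ht : 0 < t) :
    HYTightCl p I a t ⊆ HYIntCl I a t ∧ VTightCl p I a t ⊆ VIntCl I a t := by
  have hp : p.Prime := Fact.out
  have hq : ∀ E, StrictMono fun i => p ^ (E + i) := fun E i j hij =>
    Nat.pow_lt_pow_right hp.one_lt (by omega)
  refine ⟨?_, ?_⟩
  · rintro x ⟨c, hc, E, h⟩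
    have h' : ∀ i, ∀ y ∈ a ^ ⌈t * ((p ^ (E + i) : ℕ) : ℝ)⌉₊,
        c * x ^ p ^ (E + i) * y ∈ I ^ p ^ (E + i) := fun i y hy => by
      push_cast at hy
      exact fbp_le_pow _ _ (h _ (by omega) y hy)
    refine exists_mem_Rcirc_forall_mul_pow_mul_mem ht _ fun P hP hx ha => ?_
    have := hP.1.1
    have hI := not_le_of_forall_mul_pow_mem (hc P hP) hx ha (pow_ne_zero _ hp.ne_zero) (h' 0)
    exact exists_notMem_forall_mul_pow_mul_mem hP ht (hc P hP) hx ha hI (hq E) h'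
  · rintro x ⟨c, hc, E, h⟩
    have h' : ∀ i, ∀ y ∈ a ^ ⌈t * (p : ℝ) ^ (E + i)⌉₊,
        c * x ^ p ^ (E + i) * y ∈ a ^ ⌈t * (p : ℝ) ^ (E + i)⌉₊ * I ^ p ^ (E + i) :=
      fun i y hy => Ideal.mul_mono_right (fbp_le_pow _ _) (h _ (by omega) y hy)
    refine exists_mem_Rcirc_forall_mul_pow_mul_mem ht _ fun P hP hx ha => ?_
    have := hP.1.1
    have hI := not_le_of_forall_mul_pow_mem (hc P hP) hx ha (pow_ne_zero _ hp.ne_zero)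
      fun y hy => Ideal.mul_le_right (h' 0 y hy)
    obtain ⟨d, hd, h⟩ := exists_notMem_forall_mul_pow_mem hP (hc P hP) ha hI (hq E) h'
    refine ⟨d, hd, fun n y hy => ?_⟩
    rw [mul_comm _ y]
    exact Ideal.mul_mem_mul hy (h n)
end

section
/- Let R be a reduced commutative Noetherian ring, let I, 𝔞 ⊆ R be ideals, and let t > 0 be a real number. Then an element x ∈ R lies in the Hara–Yoshida 𝔞ᵗ-integral closure Ī^{𝔞ᵗ} if and only if, for every minimal prime 𝔭 of R, the image of x in R/𝔭 lies in the Hara–Yoshida 𝔟ᵗ-integral closure of the ideal (I+𝔭)/𝔭 of R/𝔭, where 𝔟 = (𝔞+𝔭)/𝔭 denotes the image of 𝔞 in R/𝔭. -/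
open Ideal Filter
open scoped Pointwise

theorem mem_Rcirc_iff_ne_zero {R : Type*} [CommRing R] [IsDomain R] {c : R} :
    c ∈ Rcirc R ↔ c ≠ 0 := by
  simp [Rcirc, IsDomain.minimalPrimes_eq_singleton_bot]

theorem eq_zero_of_forall_mem_minimalPrimes {R : Type*} [CommRing R] [IsReduced R] {z : R}
    (h : ∀ P ∈ minimalPrimes R, z ∈ P) : z = 0 := by
  have hz : z ∈ sInf (minimalPrimes R) := Submodule.mem_sInf.mpr h
  rw [minimalPrimes, Ideal.sInf_minimalPrimes] at hz
  obtain ⟨n, hn⟩ := hz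
  exact eq_zero_of_pow_eq_zero hn

theorem exists_notMem_minimalPrime_mem_others {R : Type*} [CommRing R] [IsNoetherianRing R]
    {P : Ideal R} (hP : P ∈ minimalPrimes R) :
    ∃ d ∉ P, ∀ Q ∈ minimalPrimes R, Q ≠ P → d ∈ Q := by
  classical
  have hfin := minimalPrimes.finite_of_isNoetherianRing R
  have hnot : ¬ (hfin.toFinset.erase P).inf id ≤ P := by
    rw [Ideal.IsPrime.inf_le' hP.1.1]
    rintro ⟨Q, hQ, hQP⟩
    rw [Finset.mem_erase, Set.Finite.mem_toFinset] at hQ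
    exact hQ.1 (le_antisymm hQP (hP.2 hQ.2.1 hQP))
  obtain ⟨d, hd, hdP⟩ := SetLike.not_le_iff_exists.mp hnot
  refine ⟨d, hdP, fun Q hQ hQP => ?_⟩
  exact Finset.inf_le (f := id) (Finset.mem_erase.mpr ⟨hQP, hfin.mem_toFinset.mpr hQ⟩) hd

theorem mk_mem_HYIntCl {R : Type*} [CommRing R] {I a P : Ideal R} {t : ℝ} {x : R}
    (hP : P ∈ minimalPrimes R) (hx : x ∈ HYIntCl I a t) :
    Ideal.Quotient.mk P x ∈
      HYIntCl (I.map (Ideal.Quotient.mk P)) (a.map (Ideal.Quotient.mk P)) t := by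
  have := hP.1.1
  obtain ⟨c, hc, N, h⟩ := hx
  refine ⟨Ideal.Quotient.mk P c, ?_, N, fun n hn y hy => ?_⟩
  · rw [mem_Rcirc_iff_ne_zero, Ne, Ideal.Quotient.eq_zero_iff_mem]
    exact hc P hP
  · rw [← Ideal.map_pow] at hy ⊢
    obtain ⟨z, hz, rfl⟩ :=
      (Ideal.mem_map_iff_of_surjective _ Ideal.Quotient.mk_surjective).mp hy
    simpa using Ideal.mem_map_of_mem (Ideal.Quotient.mk P) (h n hn z hz)

theorem exists_multiplier_of_mk_mem_HYIntCl {R : Type*} [CommRing R] [IsNoetherianRing R]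
    [IsReduced R] {I a P : Ideal R} {t : ℝ} {x : R} (hP : P ∈ minimalPrimes R)
    (hx : Ideal.Quotient.mk P x ∈
      HYIntCl (I.map (Ideal.Quotient.mk P)) (a.map (Ideal.Quotient.mk P)) t) :
    ∃ e ∉ P, (∀ Q ∈ minimalPrimes R, Q ≠ P → e ∈ Q) ∧
      ∃ N : ℕ, ∀ n : ℕ, N ≤ n → ∀ y ∈ a ^ ⌈t * (n : ℝ)⌉₊, e * x ^ n * y ∈ I ^ n := by
  have := hP.1.1
  obtain ⟨c, hc, N, h⟩ := hx
  obtain ⟨c, rfl⟩ := Ideal.Quotient.mk_surjective c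
  rw [mem_Rcirc_iff_ne_zero, Ne, Ideal.Quotient.eq_zero_iff_mem] at hc
  obtain ⟨d, hdP, hd⟩ := exists_notMem_minimalPrime_mem_others hP
  refine ⟨d * c, fun hdc => (hP.1.1.mem_or_mem hdc).elim hdP hc,
    fun Q hQ hQP => Q.mul_mem_right c (hd Q hQ hQP), N, fun n hn y hy => ?_⟩
  have hmem := h n hn (Ideal.Quotient.mk P y)
    (by rw [← Ideal.map_pow]; exact Ideal.mem_map_of_mem _ hy)
  rw [← Ideal.map_pow, Ideal.mem_map_iff_of_surjective _ Ideal.Quotient.mk_surjective] at hmem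
  obtain ⟨z, hz, hzeq⟩ := hmem
  rw [← map_pow, ← map_mul, ← map_mul, Ideal.Quotient.eq] at hzeq
  have hzero : d * (z - c * x ^ n * y) = 0 :=
    eq_zero_of_forall_mem_minimalPrimes fun Q hQ => by
      by_cases hQP : Q = P
      · exact Q.mul_mem_left d (hQP ▸ hzeq)
      · exact Q.mul_mem_right _ (hd Q hQ hQP)
  have heq : d * c * x ^ n * y = d * z := by linear_combination -hzero
  exact heq ▸ Ideal.mul_mem_left _ d hz

theorem HY_integral_closure_via_minimal_primes {R : Type*} [CommRing R]
    [IsNoetherianRing R] [IsReduced R] (I a : Ideal R) (t : ℝ) (ht : 0 < t) (x : R) :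
    x ∈ HYIntCl I a t ↔
      ∀ P ∈ minimalPrimes R,
        Ideal.Quotient.mk P x ∈
          HYIntCl (I.map (Ideal.Quotient.mk P)) (a.map (Ideal.Quotient.mk P)) t := by
  refine ⟨fun hx P hP => mk_mem_HYIntCl hP hx, fun hx => ?_⟩
  choose e heP heQ N h using fun P : minimalPrimes R =>
    exists_multiplier_of_mk_mem_HYIntCl P.2 (hx P P.2)
  have := (minimalPrimes.finite_of_isNoetherianRing R).fintype
  refine ⟨∑ P, e P, fun P hP hmem => ?_, Finset.univ.sup N, fun n hn y hy => ?_⟩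
  · classical
    rw [← Finset.add_sum_erase _ _ (Finset.mem_univ (⟨P, hP⟩ : minimalPrimes R))] at hmem
    refine heP ⟨P, hP⟩ ((Ideal.add_mem_iff_left P (Ideal.sum_mem P fun Q hQ => ?_)).mp hmem)
    exact heQ Q P hP fun hPQ => Finset.ne_of_mem_erase hQ (Subtype.ext hPQ.symm)
  · rw [Finset.sum_mul, Finset.sum_mul]
    exact Ideal.sum_mem _ fun P _ =>
      h P n ((Finset.le_sup (Finset.mem_univ P)).trans hn) y hy
end
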